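/- arXiv:2212.09844 — 15 statements merged into one kernel-verified Lean document; each statement's English description precedes it below -/
import Mathlib

section
/- The identified set { ∫(β0 + β1·μ1 + β1·π0·δ) dP : δ ∈ Δ } is exactly the closed interval [perf_low, perf_high], where perf_high = ∫(β0 + β1·μ1 + β1·π0·(1{β1>0}·δhigh + 1{β1≤0}·δlow)) dP and perf_low = ∫(β0 + β1·μ1 + β1·π0·(1{β1≤0}·δhigh + 1{β1>0}·δlow)) dP. -/
open MeasureTheory

/-- The integrand of the performance functional is integrable for every bounded measurable
confounding function. -/
theorem integrable_performance_integrand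
    {𝒳 : Type*} [MeasurableSpace 𝒳] {P : Measure 𝒳} [IsFiniteMeasure P]
    {μ1 π0 β0 β1 δ : 𝒳 → ℝ}
    (hμ1m : Measurable μ1) (hπ0m : Measurable π0)
    (hβ0m : Measurable β0) (hβ1m : Measurable β1) (hδm : Measurable δ)
    (hμ1b : ∃ C, ∀ x, |μ1 x| ≤ C) (hπ0b : ∃ C, ∀ x, |π0 x| ≤ C)
    (hβ0b : ∃ C, ∀ x, |β0 x| ≤ C) (hβ1b : ∃ C, ∀ x, |β1 x| ≤ C)
    (hδb : ∃ C, ∀ x, |δ x| ≤ C) :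
    Integrable (fun x => β0 x + β1 x * μ1 x + β1 x * π0 x * δ x) P := by
  obtain ⟨Cμ, hμ⟩ := hμ1b
  obtain ⟨Cπ, hπ⟩ := hπ0b
  obtain ⟨C0, h0⟩ := hβ0b
  obtain ⟨C1, h1⟩ := hβ1b
  obtain ⟨Cδ, hδ⟩ := hδb
  refine Integrable.of_bound (C := C0 + C1 * Cμ + C1 * Cπ * Cδ)
    (by fun_prop) (Filter.Eventually.of_forall fun x => ?_)
  have hC1 : 0 ≤ C1 := (abs_nonneg _).trans (h1 x)
  have hCπ : 0 ≤ Cπ := (abs_nonneg _).trans (hπ x)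
  calc ‖β0 x + β1 x * μ1 x + β1 x * π0 x * δ x‖
      ≤ |β0 x| + |β1 x * μ1 x| + |β1 x * π0 x * δ x| := abs_add_three _ _ _
    _ = |β0 x| + |β1 x| * |μ1 x| + |β1 x| * |π0 x| * |δ x| := by simp only [abs_mul]
    _ ≤ C0 + C1 * Cμ + C1 * Cπ * Cδ := by
      gcongr
      exacts [h0 x, h1 x, hμ x, h1 x, hπ x, hδ x]

/-- The identified set for the overall performance estimand,
`{ ∫ (β0 + β1 μ1 + β1 π0 δ) dP : δlow ≤ δ ≤ δhigh }`,
is exactly the closed interval `[perf_low, perf_high]`. -/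
theorem overall_performance_identified_set
    {𝒳 : Type*} [MeasurableSpace 𝒳] (P : Measure 𝒳) [IsProbabilityMeasure P]
    (μ1 π0 δlow δhigh β0 β1 : 𝒳 → ℝ)
    (hμ1m : Measurable μ1) (hπ0m : Measurable π0)
    (hδlm : Measurable δlow) (hδhm : Measurable δhigh)
    (hβ0m : Measurable β0) (hβ1m : Measurable β1)
    (hμ1b : ∃ C, ∀ x, |μ1 x| ≤ C) (hπ0b : ∃ C, ∀ x, |π0 x| ≤ C)
    (hδlb : ∃ C, ∀ x, |δlow x| ≤ C) (hδhb : ∃ C, ∀ x, |δhigh x| ≤ C)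
    (hβ0b : ∃ C, ∀ x, |β0 x| ≤ C) (hβ1b : ∃ C, ∀ x, |β1 x| ≤ C)
    (hπ0 : ∀ x, 0 ≤ π0 x) (hδ : ∀ x, δlow x ≤ δhigh x) :
    {r : ℝ | ∃ δ : 𝒳 → ℝ, Measurable δ ∧ (∀ x, δlow x ≤ δ x ∧ δ x ≤ δhigh x) ∧
        r = ∫ x, β0 x + β1 x * μ1 x + β1 x * π0 x * δ x ∂P} =
      Set.Icc
        (∫ x, β0 x + β1 x * μ1 x +
          β1 x * π0 x * (if β1 x ≤ 0 then δhigh x else δlow x) ∂P)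
        (∫ x, β0 x + β1 x * μ1 x +
          β1 x * π0 x * (if 0 < β1 x then δhigh x else δlow x) ∂P) := by
  have hbdd : ∀ δ : 𝒳 → ℝ, (∀ x, δlow x ≤ δ x ∧ δ x ≤ δhigh x) → ∃ C, ∀ x, |δ x| ≤ C := by
    intro δ h
    obtain ⟨Cl, hl⟩ := hδlb
    obtain ⟨Ch, hh⟩ := hδhb
    exact ⟨max Cl Ch, fun x => (abs_le_max_abs_abs (h x).1 (h x).2).trans
      (max_le_max (hl x) (hh x))⟩
  have hint : ∀ δ : 𝒳 → ℝ, Measurable δ → (∀ x, δlow x ≤ δ x ∧ δ x ≤ δhigh x) →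
      Integrable (fun x => β0 x + β1 x * μ1 x + β1 x * π0 x * δ x) P := fun δ hm h =>
    integrable_performance_integrand hμ1m hπ0m hβ0m hβ1m hm hμ1b hπ0b hβ0b hβ1b (hbdd δ h)
  have hminm : Measurable fun x => if β1 x ≤ 0 then δhigh x else δlow x :=
    Measurable.ite (measurableSet_le hβ1m measurable_const) hδhm hδlm
  have hmaxm : Measurable fun x => if 0 < β1 x then δhigh x else δlow x :=
    Measurable.ite (measurableSet_lt measurable_const hβ1m) hδhm hδlm
  have hmin : ∀ x, δlow x ≤ (if β1 x ≤ 0 then δhigh x else δlow x) ∧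
      (if β1 x ≤ 0 then δhigh x else δlow x) ≤ δhigh x := by
    intro x
    split_ifs <;> simp [hδ x]
  have hmax : ∀ x, δlow x ≤ (if 0 < β1 x then δhigh x else δlow x) ∧
      (if 0 < β1 x then δhigh x else δlow x) ≤ δhigh x := by
    intro x
    split_ifs <;> simp [hδ x]
  have hintmin := hint _ hminm hmin
  have hintmax := hint _ hmaxm hmax
  ext r
  constructor
  · rintro ⟨δ, hm, hb, rfl⟩
    refine ⟨integral_mono hintmin (hint δ hm hb) fun x => ?_,
      integral_mono (hint δ hm hb) hintmax fun x => ?_⟩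
    · dsimp only
      refine add_le_add_right ?_ _
      split_ifs with h
      · exact mul_le_mul_of_nonpos_left (hb x).2 (mul_nonpos_of_nonpos_of_nonneg h (hπ0 x))
      · exact mul_le_mul_of_nonneg_left (hb x).1 (mul_nonneg (not_le.mp h).le (hπ0 x))
    · dsimp only
      refine add_le_add_right ?_ _
      split_ifs with h
      · exact mul_le_mul_of_nonneg_left (hb x).2 (mul_nonneg h.le (hπ0 x))
      · exact mul_le_mul_of_nonpos_left (hb x).1
          (mul_nonpos_of_nonpos_of_nonneg (not_lt.mp h) (hπ0 x))
  · intro hr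
    rw [← segment_eq_Icc (hr.1.trans hr.2)] at hr
    obtain ⟨a, b, ha, hb, hab, rfl⟩ := hr
    refine ⟨fun x => a * (if β1 x ≤ 0 then δhigh x else δlow x) +
      b * (if 0 < β1 x then δhigh x else δlow x),
      (hminm.const_mul a).add (hmaxm.const_mul b),
      fun x => convex_Icc (δlow x) (δhigh x) (hmin x) (hmax x) ha hb hab, ?_⟩
    rw [smul_eq_mul, smul_eq_mul, ← integral_const_mul, ← integral_const_mul,
      ← integral_add (hintmin.const_mul a) (hintmax.const_mul b)]
    refine integral_congr_ae (Filter.Eventually.of_forall fun x => ?_)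
    dsimp only
    linear_combination (β0 x + β1 x * μ1 x) * hab
end

section
/- Assume ∫(μ1 + π0·δlow) dP > 0, so that the denominator ∫(μ1 + π0·δ) dP is positive for every δ ∈ Δ. Define perf₊(δ) = ∫(β0·μ1 + β0·π0·δ) dP / ∫(μ1 + π0·δ) dP. Then for any δ1, δ2 ∈ Δ and any λ ∈ [0,1] there exists δ ∈ Δ with perf₊(δ) = λ·perf₊(δ1) + (1−λ)·perf₊(δ2). Consequently the set { perf₊(δ) : δ ∈ Δ } is convex (an interval in ℝ). -/
open MeasureTheory

theorem integrable_of_measurable_of_abs_le {𝒳 : Type*} [MeasurableSpace 𝒳] {P : Measure 𝒳}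
    [IsFiniteMeasure P] {f : 𝒳 → ℝ} (hf : Measurable f) (hb : ∃ C, ∀ x, |f x| ≤ C) :
    Integrable f P := by
  obtain ⟨C, hC⟩ := hb
  exact Integrable.of_bound hf.aestronglyMeasurable C (ae_of_all _ hC)

theorem exists_abs_mul_le {𝒳 : Type*} {f g : 𝒳 → ℝ} (hf : ∃ C, ∀ x, |f x| ≤ C)
    (hg : ∃ C, ∀ x, |g x| ≤ C) : ∃ C, ∀ x, |f x * g x| ≤ C := by
  obtain ⟨A, hA⟩ := hf
  obtain ⟨B, hB⟩ := hg
  refine ⟨A * B, fun x => ?_⟩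
  rw [abs_mul]
  exact mul_le_mul (hA x) (hB x) (abs_nonneg _) ((abs_nonneg _).trans (hA x))

theorem exists_abs_le_of_between {𝒳 : Type*} {f g h : 𝒳 → ℝ} (hf : ∃ C, ∀ x, |f x| ≤ C)
    (hh : ∃ C, ∀ x, |h x| ≤ C) (hg : ∀ x, f x ≤ g x ∧ g x ≤ h x) : ∃ C, ∀ x, |g x| ≤ C := by
  obtain ⟨A, hA⟩ := hf
  obtain ⟨B, hB⟩ := hh
  exact ⟨max A B, fun x =>
    (abs_le_max_abs_abs (hg x).1 (hg x).2).trans (max_le_max (hA x) (hB x))⟩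

/-- An affine integral functional respects affine combinations. -/
theorem integral_add_mul_affine_combination {𝒳 : Type*} [MeasurableSpace 𝒳] {P : Measure 𝒳}
    {a b f g : 𝒳 → ℝ} (hf : Integrable (fun x => a x + b x * f x) P)
    (hg : Integrable (fun x => a x + b x * g x) P) (t : ℝ) :
    ∫ x, a x + b x * (t * f x + (1 - t) * g x) ∂P =
      t * ∫ x, a x + b x * f x ∂P + (1 - t) * ∫ x, a x + b x * g x ∂P := by
  rw [← integral_const_mul, ← integral_const_mul,
    ← integral_add (hf.const_mul t) (hg.const_mul (1 - t))]
  congr 1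
  ext x
  ring

/-- Mixing numerators and denominators with a suitable weight `t` gives a fraction equal to
the `l`-mixture of the two fractions. -/
theorem exists_weight_div_eq {D₁ D₂ l : ℝ} (N₁ N₂ : ℝ) (h₁ : 0 < D₁) (h₂ : 0 < D₂)
    (hl : l ∈ Set.Icc (0 : ℝ) 1) :
    ∃ t ∈ Set.Icc (0 : ℝ) 1, (t * N₁ + (1 - t) * N₂) / (t * D₁ + (1 - t) * D₂) =
      l * (N₁ / D₁) + (1 - l) * (N₂ / D₂) := by
  obtain ⟨hl0, hl1⟩ := hl
  have hm : 0 ≤ 1 - l := sub_nonneg.2 hl1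
  have hS : 0 < l * D₂ + (1 - l) * D₁ := by
    rcases hl0.eq_or_lt with rfl | hpos
    · simpa using h₁
    · exact add_pos_of_pos_of_nonneg (mul_pos hpos h₂) (mul_nonneg hm h₁.le)
  refine ⟨l * D₂ / (l * D₂ + (1 - l) * D₁), ⟨by positivity, ?_⟩, ?_⟩
  · rw [div_le_one hS]
    exact le_add_of_nonneg_right (mul_nonneg hm h₁.le)
  · have hcompl : 1 - l * D₂ / (l * D₂ + (1 - l) * D₁) =
        (1 - l) * D₁ / (l * D₂ + (1 - l) * D₁) := by
      rw [eq_div_iff hS.ne', sub_mul, div_mul_cancel₀ _ hS.ne']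
      ring
    have hden : l * D₂ / (l * D₂ + (1 - l) * D₁) * D₁ +
        (1 - l) * D₁ / (l * D₂ + (1 - l) * D₁) * D₂ = D₁ * D₂ / (l * D₂ + (1 - l) * D₁) := by
      field_simp
      ring
    rw [hcompl, hden]
    field_simp

/-- The identified set for the positive class performance (a linear-fractional functional
of the confounding function `δ`) is convex: any convex combination of two attainable
values is itself attained by some confounding function in `Δ`. -/
theorem positive_class_identified_set_convex
    {𝒳 : Type*} [MeasurableSpace 𝒳] (P : Measure 𝒳) [IsProbabilityMeasure P]
    (μ1 π0 δlow δhigh β0 : 𝒳 → ℝ)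
    (hμ1m : Measurable μ1) (hπ0m : Measurable π0)
    (hδlm : Measurable δlow) (hδhm : Measurable δhigh)
    (hβ0m : Measurable β0)
    (hμ1b : ∃ C, ∀ x, |μ1 x| ≤ C) (hπ0b : ∃ C, ∀ x, |π0 x| ≤ C)
    (hδlb : ∃ C, ∀ x, |δlow x| ≤ C) (hδhb : ∃ C, ∀ x, |δhigh x| ≤ C)
    (hβ0b : ∃ C, ∀ x, |β0 x| ≤ C)
    (hπ0 : ∀ x, 0 ≤ π0 x) (hδ : ∀ x, δlow x ≤ δhigh x)
    (hden : 0 < ∫ x, μ1 x + π0 x * δlow x ∂P) :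
    (∀ δ1 δ2 : 𝒳 → ℝ,
      Measurable δ1 → (∀ x, δlow x ≤ δ1 x ∧ δ1 x ≤ δhigh x) →
      Measurable δ2 → (∀ x, δlow x ≤ δ2 x ∧ δ2 x ≤ δhigh x) →
      ∀ l : ℝ, l ∈ Set.Icc (0 : ℝ) 1 →
        ∃ δ : 𝒳 → ℝ, Measurable δ ∧ (∀ x, δlow x ≤ δ x ∧ δ x ≤ δhigh x) ∧
          (∫ x, β0 x * μ1 x + β0 x * π0 x * δ x ∂P) / (∫ x, μ1 x + π0 x * δ x ∂P) =
            l * ((∫ x, β0 x * μ1 x + β0 x * π0 x * δ1 x ∂P) /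
                  (∫ x, μ1 x + π0 x * δ1 x ∂P)) +
            (1 - l) * ((∫ x, β0 x * μ1 x + β0 x * π0 x * δ2 x ∂P) /
                  (∫ x, μ1 x + π0 x * δ2 x ∂P)))
    ∧
    Convex ℝ
      {r : ℝ | ∃ δ : 𝒳 → ℝ, Measurable δ ∧ (∀ x, δlow x ≤ δ x ∧ δ x ≤ δhigh x) ∧
        r = (∫ x, β0 x * μ1 x + β0 x * π0 x * δ x ∂P) /
              (∫ x, μ1 x + π0 x * δ x ∂P)} := by
  have hint : ∀ δ : 𝒳 → ℝ, Measurable δ → (∃ C, ∀ x, |δ x| ≤ C) →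
      Integrable (fun x => μ1 x + π0 x * δ x) P ∧
      Integrable (fun x => β0 x * μ1 x + β0 x * π0 x * δ x) P := fun δ hm hb =>
    ⟨(integrable_of_measurable_of_abs_le hμ1m hμ1b).add
      (integrable_of_measurable_of_abs_le (hπ0m.mul hm) (exists_abs_mul_le hπ0b hb)),
    (integrable_of_measurable_of_abs_le (hβ0m.mul hμ1m) (exists_abs_mul_le hβ0b hμ1b)).add
      (integrable_of_measurable_of_abs_le ((hβ0m.mul hπ0m).mul hm)
        (exists_abs_mul_le (exists_abs_mul_le hβ0b hπ0b) hb))⟩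
  have hpos : ∀ δ : 𝒳 → ℝ, Measurable δ → (∀ x, δlow x ≤ δ x ∧ δ x ≤ δhigh x) →
      0 < ∫ x, μ1 x + π0 x * δ x ∂P := fun δ hm hb =>
    hden.trans_le <| integral_mono (hint δlow hδlm hδlb).1
      (hint δ hm (exists_abs_le_of_between hδlb hδhb hb)).1 fun x =>
        add_le_add_right (mul_le_mul_of_nonneg_left (hb x).1 (hπ0 x)) (μ1 x)
  refine (fun hmix => ⟨hmix, ?convex⟩) ?mixture
  case convex =>
    rintro _ ⟨δ1, hm1, hb1, rfl⟩ _ ⟨δ2, hm2, hb2, rfl⟩ a b ha hb hab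
    obtain rfl : b = 1 - a := by linarith
    obtain ⟨δ, hm, hbδ, h⟩ := hmix δ1 δ2 hm1 hb1 hm2 hb2 a ⟨ha, by linarith⟩
    exact ⟨δ, hm, hbδ, h.symm⟩
  case mixture =>
    intro δ1 δ2 hm1 hb1 hm2 hb2 l hl
    obtain ⟨t, ⟨ht0, ht1⟩, ht⟩ := exists_weight_div_eq
      (∫ x, β0 x * μ1 x + β0 x * π0 x * δ1 x ∂P) (∫ x, β0 x * μ1 x + β0 x * π0 x * δ2 x ∂P)
      (hpos δ1 hm1 hb1) (hpos δ2 hm2 hb2) hl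
    have hi1 := hint δ1 hm1 (exists_abs_le_of_between hδlb hδhb hb1)
    have hi2 := hint δ2 hm2 (exists_abs_le_of_between hδlb hδhb hb2)
    refine ⟨fun x => t * δ1 x + (1 - t) * δ2 x, (hm1.const_mul t).add (hm2.const_mul (1 - t)),
      fun x => convex_Icc (δlow x) (δhigh x) (hb1 x) (hb2 x) ht0 (sub_nonneg.2 ht1)
        (add_sub_cancel t 1), ?_⟩
    rw [← ht, ← integral_add_mul_affine_combination hi1.1 hi2.1 t,
      ← integral_add_mul_affine_combination hi1.2 hi2.2 t]
end

section
/- Let β be a bounded measurable function of X. Then E[ β(X)·(φ̂_μ − φ_μ) ] = E[ β(X)·(μ̂1(X) − μ1(X))·(π̂1(X) − π1(X)) / π̂1(X) ], where φ_μ = μ1(X) + (D/π1(X))·(Y − μ1(X)) and φ̂_μ = μ̂1(X) + (D/π̂1(X))·(Y − μ̂1(X)). In particular the bias of the plug-in uncentered efficient influence function is a product of the two nuisance estimation errors (double robustness). -/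
open MeasureTheory

/-- If `h` is a version of the conditional expectation of `f` given `m` and `g` is `m`-measurable,
then `g * h` is integrable with the same integral as `g * f`. -/
lemma integrable_mul_and_integral_mul_eq_of_condExp_ae_eq
    {Ω : Type*} {m m0 : MeasurableSpace Ω} {P : Measure Ω} [IsFiniteMeasure P] (hm : m ≤ m0)
    {f g h : Ω → ℝ} (hf : Integrable f P) (hg : StronglyMeasurable[m] g)
    (hgf : Integrable (fun ω => g ω * f ω) P) (hfh : P[f | m] =ᵐ[P] h) :
    Integrable (fun ω => g ω * h ω) P ∧ ∫ ω, g ω * f ω ∂P = ∫ ω, g ω * h ω ∂P := by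
  have key : P[fun ω => g ω * f ω | m] =ᵐ[P] fun ω => g ω * h ω := by
    filter_upwards [condExp_mul_of_stronglyMeasurable_left hg hgf hf, hfh] with ω h1 h2
    exact h1.trans (congrArg (g ω * ·) h2)
  exact ⟨integrable_condExp.congr key, by rw [← integral_condExp hm, integral_congr_ae key]⟩

/-- The quotient of a bounded function by a function bounded away from zero is bounded. -/
lemma ae_norm_div_le {Ω : Type*} {m0 : MeasurableSpace Ω} {P : Measure Ω} {b p : Ω → ℝ}
    {C ε : ℝ} (hε : 0 < ε) (hb : ∀ ω, |b ω| ≤ C) (hp : ∀ᵐ ω ∂P, ε ≤ p ω) :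
    ∀ᵐ ω ∂P, ‖b ω / p ω‖ ≤ C / ε := by
  filter_upwards [hp] with ω hω
  rw [Real.norm_eq_abs, abs_div, abs_of_pos (hε.trans_le hω)]
  exact div_le_div₀ ((abs_nonneg _).trans (hb ω)) (hb ω) hε hω

/-- Double robustness of the uncentered efficient influence function `φ_μ`:
the bias of the plug-in influence function, weighted by any bounded measurable
function of the covariates, is a product of the two nuisance estimation errors. -/
theorem double_robustness_phi_mu
    {Ω : Type*} [MeasurableSpace Ω] (P : Measure Ω) [IsProbabilityMeasure P]
    {𝒳 : Type*} [m𝒳 : MeasurableSpace 𝒳]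
    (X : Ω → 𝒳) (D Y : Ω → ℝ)
    (hX : Measurable X) (hD : Measurable D) (hY : Measurable Y)
    (hD01 : ∀ ω, D ω = 0 ∨ D ω = 1) (hYint : Integrable Y P)
    (π1 μ1 : 𝒳 → ℝ) (hπ1m : Measurable π1) (hμ1m : Measurable μ1)
    (δ : ℝ) (hδ : 0 < δ) (hπ1δ : ∀ᵐ ω ∂P, δ ≤ π1 (X ω))
    (hcondD : P[D | m𝒳.comap X] =ᵐ[P] fun ω => π1 (X ω))
    (hcondDY : P[fun ω => D ω * Y ω | m𝒳.comap X] =ᵐ[P]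
      fun ω => π1 (X ω) * μ1 (X ω))
    (πh μh : 𝒳 → ℝ) (hπhm : Measurable πh) (hμhm : Measurable μh)
    (hπhb : ∃ C, ∀ x, |πh x| ≤ C) (hμhb : ∃ C, ∀ x, |μh x| ≤ C)
    (ε : ℝ) (hε : 0 < ε) (hπhε : ∀ᵐ ω ∂P, ε ≤ πh (X ω))
    (β : 𝒳 → ℝ) (hβm : Measurable β) (hβb : ∃ C, ∀ x, |β x| ≤ C) :
    ∫ ω, β (X ω) *
        ((μh (X ω) + D ω / πh (X ω) * (Y ω - μh (X ω))) -
         (μ1 (X ω) + D ω / π1 (X ω) * (Y ω - μ1 (X ω)))) ∂P =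
      ∫ ω, β (X ω) *
        ((μh (X ω) - μ1 (X ω)) * (πh (X ω) - π1 (X ω)) / πh (X ω)) ∂P := by
  obtain ⟨Cβ, hCβ⟩ := hβb
  obtain ⟨Cμ, hCμ⟩ := hμhb
  have hm := hX.comap_le
  have sm {g : 𝒳 → ℝ} (hg : Measurable g) :
      StronglyMeasurable[m𝒳.comap X] fun ω => g (X ω) :=
    (hg.comp (comap_measurable X)).stronglyMeasurable
  have hDb : ∀ᵐ ω ∂P, ‖D ω‖ ≤ 1 := .of_forall fun ω => by
    rcases hD01 ω with h | h <;> simp [h]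
  have hDint : Integrable D P := .of_bound hD.aestronglyMeasurable 1 hDb
  have hDYint : Integrable (fun ω => D ω * Y ω) P :=
    hYint.bdd_mul hD.aestronglyMeasurable hDb
  have hπμint : Integrable (fun ω => π1 (X ω) * μ1 (X ω)) P :=
    integrable_condExp.congr hcondDY
  have hinv : ∀ᵐ ω ∂P, ‖1 / π1 (X ω)‖ ≤ 1 / δ :=
    ae_norm_div_le (b := fun _ => 1) hδ (by simp) hπ1δ
  have hμ1int : Integrable (fun ω => μ1 (X ω)) P := by
    refine (hπμint.bdd_mul (f := fun ω => 1 / π1 (X ω))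
      (Measurable.aestronglyMeasurable (by fun_prop)) hinv).congr ?_
    filter_upwards [hπ1δ] with ω h
    have : π1 (X ω) ≠ 0 := (hδ.trans_le h).ne'
    field_simp
  have hμhint : Integrable (fun ω => μh (X ω)) P :=
    .of_bound (hμhm.comp hX).aestronglyMeasurable Cμ (.of_forall fun ω => hCμ _)
  have hβπh := ae_norm_div_le hε (fun ω => hCβ (X ω)) hπhε
  have hβπ1 := ae_norm_div_le hδ (fun ω => hCβ (X ω)) hπ1δ
  let g₁ : 𝒳 → ℝ := fun x => β x / πh x - β x / π1 x
  let g₂ : 𝒳 → ℝ := fun x => β x / π1 x * μ1 x - β x / πh x * μh x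
  have hg₁m : Measurable g₁ := by fun_prop
  have hg₂m : Measurable g₂ := by fun_prop
  have hg₁DY : Integrable (fun ω => g₁ (X ω) * (D ω * Y ω)) P := by
    refine ((hDYint.bdd_mul (Measurable.aestronglyMeasurable (by fun_prop)) hβπh).sub
      (hDYint.bdd_mul (Measurable.aestronglyMeasurable (by fun_prop)) hβπ1)).congr
      (.of_forall fun ω => ?_)
    simp only [g₁, Pi.sub_apply]
    ring
  have hg₂int : Integrable (fun ω => g₂ (X ω)) P :=
    (hμ1int.bdd_mul (Measurable.aestronglyMeasurable (by fun_prop)) hβπ1).sub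
      (hμhint.bdd_mul (Measurable.aestronglyMeasurable (by fun_prop)) hβπh)
  have hg₂D : Integrable (fun ω => g₂ (X ω) * D ω) P :=
    hg₂int.mul_bdd hD.aestronglyMeasurable hDb
  have hrest : Integrable (fun ω => β (X ω) * (μh (X ω) - μ1 (X ω))) P :=
    (hμhint.sub hμ1int).bdd_mul (hβm.comp hX).aestronglyMeasurable
      (.of_forall fun ω => hCβ (X ω))
  obtain ⟨hi₁, he₁⟩ := integrable_mul_and_integral_mul_eq_of_condExp_ae_eq hm hDYint
    (sm hg₁m) hg₁DY hcondDY
  obtain ⟨hi₂, he₂⟩ := integrable_mul_and_integral_mul_eq_of_condExp_ae_eq hm hDint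
    (sm hg₂m) hg₂D hcondD
  calc
    _ = ∫ ω, (g₁ (X ω) * (D ω * Y ω) + g₂ (X ω) * D ω)
          + β (X ω) * (μh (X ω) - μ1 (X ω)) ∂P := by
      refine integral_congr_ae (.of_forall fun ω => ?_)
      simp only [g₁, g₂]
      ring
    _ = ∫ ω, (g₁ (X ω) * (π1 (X ω) * μ1 (X ω)) + g₂ (X ω) * π1 (X ω))
          + β (X ω) * (μh (X ω) - μ1 (X ω)) ∂P := by
      rw [integral_add (hg₁DY.fun_add hg₂D) hrest, integral_add hg₁DY hg₂D,
        integral_add (hi₁.fun_add hi₂) hrest, integral_add hi₁ hi₂, he₁, he₂]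
    _ = _ := by
      refine integral_congr_ae ?_
      filter_upwards [hπ1δ, hπhε] with ω h1 h2
      have h1' : π1 (X ω) ≠ 0 := (hδ.trans_le h1).ne'
      have h2' : πh (X ω) ≠ 0 := (hε.trans_le h2).ne'
      simp only [g₁, g₂]
      field_simp
      ring
end

section
/- Let β be a bounded measurable function of X, and write π0 = 1 − π1, π̂0 = 1 − π̂1. Then E[ β(X)·(φ̂_{πμ} − φ_{πμ}) ] = E[ β(X)·( (μ̂1(X) − μ1(X))·(π0(X) − π̂0(X)) + (π̂0(X)/π̂1(X))·(π1(X) − π̂1(X))·(μ1(X) − μ̂1(X)) ) ], where φ_{πμ} = ((1−D) − π0(X))·μ1(X) + (D/π1(X))·(Y − μ1(X))·π0(X) + π0(X)·μ1(X) and φ̂_{πμ} is the same expression with π1, π0, μ1 replaced by π̂1, π̂0, μ̂1. -/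
open MeasureTheory

/-- If `E[Z | X] = g` and `a(X) Z` is integrable, then `a(X) g` is integrable with the same
integral as `a(X) Z`. -/
theorem integrable_and_integral_comp_mul_of_condExp_comap_eq
    {Ω : Type*} [MeasurableSpace Ω] {P : Measure Ω} [IsFiniteMeasure P]
    {𝒳 : Type*} [m𝒳 : MeasurableSpace 𝒳] {X : Ω → 𝒳} (hX : Measurable X)
    {Z g : Ω → ℝ} (hZ : Integrable Z P) (hg : P[Z | m𝒳.comap X] =ᵐ[P] g)
    {a : 𝒳 → ℝ} (ha : Measurable a) (haZ : Integrable (fun ω => a (X ω) * Z ω) P) :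
    Integrable (fun ω => a (X ω) * g ω) P ∧
      ∫ ω, a (X ω) * Z ω ∂P = ∫ ω, a (X ω) * g ω ∂P := by
  have ham : StronglyMeasurable[m𝒳.comap X] (fun ω => a (X ω)) :=
    (ha.comp (comap_measurable X)).stronglyMeasurable
  have h : P[fun ω => a (X ω) * Z ω | m𝒳.comap X] =ᵐ[P] fun ω => a (X ω) * g ω :=
    (condExp_mul_of_stronglyMeasurable_left ham haZ hZ).trans (hg.mono fun ω hω => by simp [hω])
  exact ⟨integrable_condExp.congr h,
    (integral_condExp hX.comap_le).symm.trans (integral_congr_ae h)⟩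

/-- Multiplying an integrable function by the inverse of a function bounded below by a positive
constant preserves integrability. -/
theorem MeasureTheory.Integrable.inv_mul_of_le
    {Ω : Type*} [MeasurableSpace Ω] {P : Measure Ω} {f g : Ω → ℝ} (hg : Integrable g P)
    (hf : AEMeasurable f P) {c : ℝ} (hc : 0 < c) (hcf : ∀ᵐ ω ∂P, c ≤ f ω) :
    Integrable (fun ω => (f ω)⁻¹ * g ω) P := by
  refine hg.bdd_mul (c := c⁻¹) hf.inv.aestronglyMeasurable ?_
  filter_upwards [hcf] with ω hω
  rw [Real.norm_of_nonneg (inv_nonneg.2 (hc.le.trans hω))]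
  exact inv_anti₀ hc hω

/-- Double robustness of the uncentered efficient influence function `φ_{πμ}` for
`E[π0(X) μ1(X)]`: the bias of the plug-in influence function, weighted by any bounded
measurable function of the covariates, is a sum of products of nuisance errors. -/
theorem double_robustness_phi_pi_mu
    {Ω : Type*} [MeasurableSpace Ω] (P : Measure Ω) [IsProbabilityMeasure P]
    {𝒳 : Type*} [m𝒳 : MeasurableSpace 𝒳]
    (X : Ω → 𝒳) (D Y : Ω → ℝ)
    (hX : Measurable X) (hD : Measurable D) (hY : Measurable Y)
    (hD01 : ∀ ω, D ω = 0 ∨ D ω = 1) (hYint : Integrable Y P)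
    (π1 μ1 : 𝒳 → ℝ) (hπ1m : Measurable π1) (hμ1m : Measurable μ1)
    (δ : ℝ) (hδ : 0 < δ) (hπ1δ : ∀ᵐ ω ∂P, δ ≤ π1 (X ω))
    (hcondD : P[D | m𝒳.comap X] =ᵐ[P] fun ω => π1 (X ω))
    (hcondDY : P[fun ω => D ω * Y ω | m𝒳.comap X] =ᵐ[P]
      fun ω => π1 (X ω) * μ1 (X ω))
    (πh μh : 𝒳 → ℝ) (hπhm : Measurable πh) (hμhm : Measurable μh)
    (hπhb : ∃ C, ∀ x, |πh x| ≤ C) (hμhb : ∃ C, ∀ x, |μh x| ≤ C)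
    (ε : ℝ) (hε : 0 < ε) (hπhε : ∀ᵐ ω ∂P, ε ≤ πh (X ω))
    (β : 𝒳 → ℝ) (hβm : Measurable β) (hβb : ∃ C, ∀ x, |β x| ≤ C) :
    ∫ ω, β (X ω) *
        ((((1 - D ω) - (1 - πh (X ω))) * μh (X ω) +
            D ω / πh (X ω) * (Y ω - μh (X ω)) * (1 - πh (X ω)) +
            (1 - πh (X ω)) * μh (X ω)) -
         (((1 - D ω) - (1 - π1 (X ω))) * μ1 (X ω) +
            D ω / π1 (X ω) * (Y ω - μ1 (X ω)) * (1 - π1 (X ω)) +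
            (1 - π1 (X ω)) * μ1 (X ω))) ∂P =
      ∫ ω, β (X ω) *
        ((μh (X ω) - μ1 (X ω)) * ((1 - π1 (X ω)) - (1 - πh (X ω))) +
          ((1 - πh (X ω)) / πh (X ω)) * (π1 (X ω) - πh (X ω)) *
            (μ1 (X ω) - μh (X ω))) ∂P := by
  obtain ⟨Cβ, hCβ⟩ := hβb
  obtain ⟨Cμ, hCμ⟩ := hμhb
  have mul_β {f : Ω → ℝ} (hf : Integrable f P) : Integrable (fun ω => β (X ω) * f ω) P :=
    hf.bdd_mul (hβm.comp hX).aestronglyMeasurable (ae_of_all _ fun ω => hCβ (X ω))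
  have mul_D {f : Ω → ℝ} (hf : Integrable f P) : Integrable (fun ω => f ω * D ω) P :=
    hf.mul_bdd (c := 1) hD.aestronglyMeasurable
      (ae_of_all _ fun ω => by rcases hD01 ω with h | h <;> simp [h])
  have inv_π1 {f : Ω → ℝ} (hf : Integrable f P) : Integrable (fun ω => (π1 (X ω))⁻¹ * f ω) P :=
    hf.inv_mul_of_le (hπ1m.comp hX).aemeasurable hδ hπ1δ
  have inv_πh {f : Ω → ℝ} (hf : Integrable f P) : Integrable (fun ω => (πh (X ω))⁻¹ * f ω) P :=
    hf.inv_mul_of_le (hπhm.comp hX).aemeasurable hε hπhε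
  have hDint : Integrable D P := by simpa using mul_D (integrable_const (1 : ℝ))
  have hDYint : Integrable (fun ω => D ω * Y ω) P := by simpa only [mul_comm] using mul_D hYint
  have hμ1int : Integrable (fun ω => μ1 (X ω)) P := by
    refine (inv_π1 (integrable_condExp.congr hcondDY)).congr ?_
    filter_upwards [hπ1δ] with ω hω
    exact inv_mul_cancel_left₀ (hδ.trans_le hω).ne' _
  have hμhint : Integrable (fun ω => μh (X ω)) P :=
    .of_bound (hμhm.comp hX).aestronglyMeasurable Cμ (ae_of_all _ fun ω => hCμ (X ω))
  -- Both sides have the form `a(X) Z + b(X) W + c(X)`, with `(Z, W) = (D, D Y)` on the left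
  -- and `(Z, W) = (E[D | X], E[D Y | X])` on the right.
  let a : 𝒳 → ℝ := fun x => β x * ((π1 x)⁻¹ * μ1 x - (πh x)⁻¹ * μh x)
  let b : 𝒳 → ℝ := fun x => β x * ((πh x)⁻¹ - (π1 x)⁻¹)
  have ha : Measurable a := by fun_prop
  have hb : Measurable b := by fun_prop
  have haD : Integrable (fun ω => a (X ω) * D ω) P :=
    mul_D (mul_β ((inv_π1 hμ1int).sub (inv_πh hμhint)))
  have hbDY : Integrable (fun ω => b (X ω) * (D ω * Y ω)) P := by
    refine (mul_β ((inv_πh hDYint).sub (inv_π1 hDYint))).congr (ae_of_all _ fun ω => ?_)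
    simp only [b, Pi.sub_apply]
    ring
  have hc : Integrable (fun ω => β (X ω) * (μh (X ω) - μ1 (X ω))) P :=
    mul_β (hμhint.sub hμ1int)
  obtain ⟨haπ, haD_eq⟩ :=
    integrable_and_integral_comp_mul_of_condExp_comap_eq hX hDint hcondD ha haD
  obtain ⟨hbπμ, hbDY_eq⟩ :=
    integrable_and_integral_comp_mul_of_condExp_comap_eq hX hDYint hcondDY hb hbDY
  calc
    _ = ∫ ω, (a (X ω) * D ω + b (X ω) * (D ω * Y ω)) +
          β (X ω) * (μh (X ω) - μ1 (X ω)) ∂P := by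
      refine integral_congr_ae ?_
      filter_upwards [hπ1δ, hπhε] with ω h1 h2
      have h1' := (hδ.trans_le h1).ne'
      have h2' := (hε.trans_le h2).ne'
      simp only [a, b]
      field_simp
      ring
    _ = ∫ ω, (a (X ω) * π1 (X ω) + b (X ω) * (π1 (X ω) * μ1 (X ω))) +
          β (X ω) * (μh (X ω) - μ1 (X ω)) ∂P := by
      rw [integral_add (haD.fun_add hbDY) hc, integral_add haD hbDY, haD_eq, hbDY_eq,
        ← integral_add haπ hbπμ, ← integral_add (haπ.fun_add hbπμ) hc]
    _ = _ := by
      refine integral_congr_ae ?_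
      filter_upwards [hπ1δ, hπhε] with ω h1 h2
      have h1' := (hδ.trans_le h1).ne'
      have h2' := (hε.trans_le h2).ne'
      simp only [a, b]
      field_simp
      ring
end

section
/- Suppose additionally that Y takes values in [0,1] and that μ1, μ̂1, π1, π̂1 all take values in [0,1]. Then the L²(P)-distance between the plug-in and true uncentered efficient influence functions satisfies ‖φ̂_μ − φ_μ‖_{L²(P)} ≤ (2/(δ·ε))·‖π̂1(X) − π1(X)‖_{L²(P)} + (1 + 1/δ)·‖μ̂1(X) − μ1(X)‖_{L²(P)}, where φ_μ = μ1(X) + (D/π1(X))·(Y − μ1(X)) and φ̂_μ = μ̂1(X) + (D/π̂1(X))·(Y − μ̂1(X)). -/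
open MeasureTheory

lemma lpNorm_two_eq_sqrt_integral_sq {α : Type*} [MeasurableSpace α] {μ : Measure α}
    {f : α → ℝ} (hf : AEStronglyMeasurable f μ) :
    lpNorm f 2 μ = Real.sqrt (∫ x, f x ^ 2 ∂μ) := by
  rw [lpNorm_eq_integral_norm_rpow_toReal two_ne_zero ENNReal.ofNat_ne_top hf,
    Real.sqrt_eq_rpow]
  simp

/-- Minkowski's inequality for a function dominated by a linear combination. -/
lemma sqrt_integral_sq_le_of_abs_le_add {α : Type*} [MeasurableSpace α] {μ : Measure α}
    {f u v : α → ℝ} {a b : ℝ} (ha : 0 ≤ a) (hb : 0 ≤ b)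
    (hu : MemLp u 2 μ) (hv : MemLp v 2 μ)
    (h : ∀ᵐ x ∂μ, |f x| ≤ a * |u x| + b * |v x|) :
    Real.sqrt (∫ x, f x ^ 2 ∂μ) ≤
      a * Real.sqrt (∫ x, u x ^ 2 ∂μ) + b * Real.sqrt (∫ x, v x ^ 2 ∂μ) := by
  have hu' : MemLp (a • |u|) 2 μ := hu.abs.const_smul a
  have hv' : MemLp (b • |v|) 2 μ := hv.abs.const_smul b
  have hg : MemLp (a • |u| + b • |v|) 2 μ := hu'.add hv'
  calc Real.sqrt (∫ x, f x ^ 2 ∂μ)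
      ≤ Real.sqrt (∫ x, (a • |u| + b • |v|) x ^ 2 ∂μ) := by
        refine Real.sqrt_le_sqrt
          (integral_mono_of_nonneg (ae_of_all _ fun x => sq_nonneg _) hg.integrable_sq ?_)
        filter_upwards [h] with x hx
        exact sq_le_sq' (neg_le_of_abs_le hx) (le_of_abs_le hx)
    _ = lpNorm (a • |u| + b • |v|) 2 μ := (lpNorm_two_eq_sqrt_integral_sq hg.1).symm
    _ ≤ lpNorm (a • |u|) 2 μ + lpNorm (b • |v|) 2 μ := lpNorm_add_le hu' one_le_two
    _ = a * Real.sqrt (∫ x, u x ^ 2 ∂μ) + b * Real.sqrt (∫ x, v x ^ 2 ∂μ) := by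
        rw [lpNorm_const_smul, lpNorm_const_smul, lpNorm_abs hu.1, lpNorm_abs hv.1,
          lpNorm_two_eq_sqrt_integral_sq hu.1, lpNorm_two_eq_sqrt_integral_sq hv.1]
        simp [abs_of_nonneg ha, abs_of_nonneg hb]

lemma abs_influence_sub_le {d y p m q n δ ε : ℝ} (hd : d = 0 ∨ d = 1)
    (hy : 0 ≤ y ∧ y ≤ 1) (hn : 0 ≤ n ∧ n ≤ 1)
    (hδ : 0 < δ) (hε : 0 < ε) (hp : δ ≤ p) (hq : ε ≤ q) :
    |(n + d / q * (y - n)) - (m + d / p * (y - m))| ≤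
      2 / (δ * ε) * |q - p| + (1 + 1 / δ) * |n - m| := by
  have hp0 : 0 < p := hδ.trans_le hp
  have hq0 : 0 < q := hε.trans_le hq
  have hd0 : |d| ≤ 1 := by rcases hd with rfl | rfl <;> simp
  have hyn : |y - n| ≤ 1 := abs_le.2 ⟨by linarith, by linarith⟩
  have hweight : |d * (y - n) / (p * q)| ≤ 2 / (δ * ε) := by
    rw [abs_div, abs_mul, abs_of_pos (mul_pos hp0 hq0)]
    gcongr
    nlinarith [abs_nonneg d, abs_nonneg (y - n)]
  have hcoef : |1 - d / p| ≤ 1 + 1 / δ := by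
    refine (abs_sub _ _).trans ?_
    rw [abs_one, abs_div, abs_of_pos hp0]
    gcongr
  calc |(n + d / q * (y - n)) - (m + d / p * (y - m))|
      = |-(d * (y - n) / (p * q) * (q - p)) + (1 - d / p) * (n - m)| := by
        congr 1
        field_simp
        ring
    _ ≤ |d * (y - n) / (p * q)| * |q - p| + |1 - d / p| * |n - m| := by
        refine (abs_add_le _ _).trans_eq ?_
        rw [abs_neg, abs_mul, abs_mul]
    _ ≤ 2 / (δ * ε) * |q - p| + (1 + 1 / δ) * |n - m| := by gcongr

/-- A difference of two `[0, 1]`-valued measurable functions is square integrable. -/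
lemma memLp_two_comp_sub_of_mem_unit {Ω 𝒳 : Type*} [MeasurableSpace Ω] [MeasurableSpace 𝒳]
    {P : Measure Ω} [IsFiniteMeasure P] {X : Ω → 𝒳} {f g : 𝒳 → ℝ}
    (hX : Measurable X) (hf : Measurable f) (hg : Measurable g)
    (hf01 : ∀ x, 0 ≤ f x ∧ f x ≤ 1) (hg01 : ∀ x, 0 ≤ g x ∧ g x ≤ 1) :
    MemLp (fun ω => f (X ω) - g (X ω)) 2 P := by
  refine MemLp.of_bound ((hf.comp hX).sub (hg.comp hX)).aestronglyMeasurable 1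
    (ae_of_all _ fun ω => ?_)
  have h₁ := hf01 (X ω)
  have h₂ := hg01 (X ω)
  exact abs_le.2 ⟨by linarith, by linarith⟩

/-- Convergence of the plug-in influence function `φ̂_μ` in `L²(P)`: its distance to
the true uncentered efficient influence function `φ_μ` is controlled by the `L²(P)`
estimation errors of the nuisance functions. -/
theorem L2_bound_plug_in_influence_function
    {Ω : Type*} [MeasurableSpace Ω] (P : Measure Ω) [IsProbabilityMeasure P]
    {𝒳 : Type*} [m𝒳 : MeasurableSpace 𝒳]
    (X : Ω → 𝒳) (D Y : Ω → ℝ)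
    (hX : Measurable X) (hD : Measurable D) (hY : Measurable Y)
    (hD01 : ∀ ω, D ω = 0 ∨ D ω = 1) (hYint : Integrable Y P)
    (hY01 : ∀ ω, 0 ≤ Y ω ∧ Y ω ≤ 1)
    (π1 μ1 : 𝒳 → ℝ) (hπ1m : Measurable π1) (hμ1m : Measurable μ1)
    (hπ101 : ∀ x, 0 ≤ π1 x ∧ π1 x ≤ 1) (hμ101 : ∀ x, 0 ≤ μ1 x ∧ μ1 x ≤ 1)
    (δ : ℝ) (hδ : 0 < δ) (hπ1δ : ∀ᵐ ω ∂P, δ ≤ π1 (X ω))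
    (hcondD : P[D | m𝒳.comap X] =ᵐ[P] fun ω => π1 (X ω))
    (hcondDY : P[fun ω => D ω * Y ω | m𝒳.comap X] =ᵐ[P]
      fun ω => π1 (X ω) * μ1 (X ω))
    (πh μh : 𝒳 → ℝ) (hπhm : Measurable πh) (hμhm : Measurable μh)
    (hπh01 : ∀ x, 0 ≤ πh x ∧ πh x ≤ 1) (hμh01 : ∀ x, 0 ≤ μh x ∧ μh x ≤ 1)
    (ε : ℝ) (hε : 0 < ε) (hπhε : ∀ᵐ ω ∂P, ε ≤ πh (X ω)) :
    Real.sqrt (∫ ω,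
        ((μh (X ω) + D ω / πh (X ω) * (Y ω - μh (X ω))) -
         (μ1 (X ω) + D ω / π1 (X ω) * (Y ω - μ1 (X ω)))) ^ 2 ∂P) ≤
      (2 / (δ * ε)) * Real.sqrt (∫ ω, (πh (X ω) - π1 (X ω)) ^ 2 ∂P) +
        (1 + 1 / δ) * Real.sqrt (∫ ω, (μh (X ω) - μ1 (X ω)) ^ 2 ∂P) := by
  refine sqrt_integral_sq_le_of_abs_le_add (by positivity) (by positivity)
    (memLp_two_comp_sub_of_mem_unit hX hπhm hπ1m hπh01 hπ101)
    (memLp_two_comp_sub_of_mem_unit hX hμhm hμ1m hμh01 hμ101) ?_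
  filter_upwards [hπ1δ, hπhε] with ω hp hq
  exact abs_influence_sub_le (hD01 ω) (hY01 ω) (hμh01 (X ω)) hδ hε hp hq
end

section
/- For any measurable decision rule d : 𝒳 → {0,1}, the set { U(d; μ) : μ measurable, μlow ≤ μ ≤ μhigh pointwise } equals the closed interval [Ulow(d), Uhigh(d)], where Ulow(d) = ∫[ (u10 − (u11 + u10)·μhigh)·d + (−u00 + (u00 + u01)·μlow)·(1 − d) ] dP and Uhigh(d) = ∫[ (u10 − (u11 + u10)·μlow)·d + (−u00 + (u00 + u01)·μhigh)·(1 − d) ] dP. -/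
open MeasureTheory

/-- The identified set for the expected welfare of a decision rule `d`, as the
conditional probability function `μ` ranges over all measurable functions with
`μlow ≤ μ ≤ μhigh`, is the closed interval `[Ulow(d), Uhigh(d)]`. -/
theorem expected_welfare_identified_set
    {𝒳 : Type*} [MeasurableSpace 𝒳] (P : Measure 𝒳) [IsProbabilityMeasure P]
    (u11 u10 u00 u01 : 𝒳 → ℝ)
    (hu11m : Measurable u11) (hu10m : Measurable u10)
    (hu00m : Measurable u00) (hu01m : Measurable u01)
    (hu11 : ∀ x, 0 ≤ u11 x) (hu10 : ∀ x, 0 ≤ u10 x)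
    (hu00 : ∀ x, 0 ≤ u00 x) (hu01 : ∀ x, 0 ≤ u01 x)
    (husum : ∀ x, u11 x + u10 x + u00 x + u01 x = 1)
    (μlow μhigh : 𝒳 → ℝ) (hμlm : Measurable μlow) (hμhm : Measurable μhigh)
    (hμbd : ∀ x, 0 ≤ μlow x ∧ μlow x ≤ μhigh x ∧ μhigh x ≤ 1)
    (d : 𝒳 → ℝ) (hdm : Measurable d) (hd01 : ∀ x, d x = 0 ∨ d x = 1) :
    {r : ℝ | ∃ μ : 𝒳 → ℝ, Measurable μ ∧ (∀ x, μlow x ≤ μ x ∧ μ x ≤ μhigh x) ∧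
        r = ∫ x, (-(u11 x) * μ x + u10 x * (1 - μ x)) * d x +
              (-(u00 x) * (1 - μ x) + u01 x * μ x) * (1 - d x) ∂P} =
      Set.Icc
        (∫ x, (u10 x - (u11 x + u10 x) * μhigh x) * d x +
            (-(u00 x) + (u00 x + u01 x) * μlow x) * (1 - d x) ∂P)
        (∫ x, (u10 x - (u11 x + u10 x) * μlow x) * d x +
            (-(u00 x) + (u00 x + u01 x) * μhigh x) * (1 - d x) ∂P) := by
  have hint : ∀ m : 𝒳 → ℝ, Measurable m → (∀ x, μlow x ≤ m x ∧ m x ≤ μhigh x) →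
      Integrable (fun x => (-(u11 x) * m x + u10 x * (1 - m x)) * d x +
        (-(u00 x) * (1 - m x) + u01 x * m x) * (1 - d x)) P := by
    intro m hm hmb
    refine Integrable.of_bound (C := 1) (by fun_prop) (ae_of_all _ fun x => ?_)
    have h0 : 0 ≤ m x := (hμbd x).1.trans (hmb x).1
    have h1 : 0 ≤ 1 - m x := sub_nonneg.2 ((hmb x).2.trans (hμbd x).2.2)
    have := husum x
    rw [Real.norm_eq_abs, abs_le]
    rcases hd01 x with h | h <;> rw [h] <;> constructor <;>
      nlinarith [hu11 x, hu10 x, hu00 x, hu01 x, mul_nonneg (hu11 x) h0, mul_nonneg (hu11 x) h1,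
        mul_nonneg (hu10 x) h0, mul_nonneg (hu10 x) h1, mul_nonneg (hu00 x) h0,
        mul_nonneg (hu00 x) h1, mul_nonneg (hu01 x) h0, mul_nonneg (hu01 x) h1]
  have hlow : Integrable (fun x => (u10 x - (u11 x + u10 x) * μhigh x) * d x +
      (-(u00 x) + (u00 x + u01 x) * μlow x) * (1 - d x)) P := by
    refine (hint (fun x => μhigh x * d x + μlow x * (1 - d x)) (by fun_prop) fun x => ?_).congr
      (ae_of_all _ fun x => ?_)
    · rcases hd01 x with h | h <;> simp [h, (hμbd x).2.1]
    · rcases hd01 x with h | h <;> simp only [h] <;> ring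
  have hhigh : Integrable (fun x => (u10 x - (u11 x + u10 x) * μlow x) * d x +
      (-(u00 x) + (u00 x + u01 x) * μhigh x) * (1 - d x)) P := by
    refine (hint (fun x => μlow x * d x + μhigh x * (1 - d x)) (by fun_prop) fun x => ?_).congr
      (ae_of_all _ fun x => ?_)
    · rcases hd01 x with h | h <;> simp [h, (hμbd x).2.1]
    · rcases hd01 x with h | h <;> simp only [h] <;> ring
  ext r
  constructor
  · rintro ⟨m, hm, hmb, rfl⟩
    constructor
    · refine integral_mono hlow (hint m hm hmb) fun x => ?_
      rcases hd01 x with h | h <;> simp only [h] <;>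
        nlinarith [mul_le_mul_of_nonneg_left (hmb x).1 (add_nonneg (hu00 x) (hu01 x)),
          mul_le_mul_of_nonneg_left (hmb x).2 (add_nonneg (hu11 x) (hu10 x))]
    · refine integral_mono (hint m hm hmb) hhigh fun x => ?_
      rcases hd01 x with h | h <;> simp only [h] <;>
        nlinarith [mul_le_mul_of_nonneg_left (hmb x).2 (add_nonneg (hu00 x) (hu01 x)),
          mul_le_mul_of_nonneg_left (hmb x).1 (add_nonneg (hu11 x) (hu10 x))]
  · intro hr
    rw [← segment_eq_Icc (hr.1.trans hr.2)] at hr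
    obtain ⟨a, b, ha, hb, hab, rfl⟩ := hr
    refine ⟨fun x => a * (μhigh x * d x + μlow x * (1 - d x)) +
      b * (μlow x * d x + μhigh x * (1 - d x)), by fun_prop, fun x => ?_, ?_⟩
    · have hle := (hμbd x).2.1
      obtain rfl : a = 1 - b := by linarith
      rcases hd01 x with h | h <;> simp only [h] <;> constructor <;>
        nlinarith [mul_le_mul_of_nonneg_left hle ha, mul_le_mul_of_nonneg_left hle hb]
    · rw [smul_eq_mul, smul_eq_mul, ← integral_const_mul, ← integral_const_mul,
        ← integral_add (hlow.const_mul a) (hhigh.const_mul b)]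
      refine integral_congr_ae (ae_of_all _ fun x => ?_)
      obtain rfl : a = 1 - b := by linarith
      rcases hd01 x with h | h <;> simp only [h] <;> ring
end

section
/- Define μ̃*(x) = (u11(x) + u10(x))·μhigh(x) + (u00(x) + u01(x))·μlow(x) and the threshold rule d*(x) = 1{ μ̃*(x) ≤ u10(x) + u00(x) }. Then d* maximizes worst-case expected welfare over all measurable decision rules: for every measurable d : 𝒳 → {0,1}, Ulow(d) ≤ Ulow(d*), where Ulow(d) = ∫[ (u10 − (u11 + u10)·μhigh)·d + (−u00 + (u00 + u01)·μlow)·(1 − d) ] dP. -/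
open MeasureTheory

/-- The welfare integrand of a binary rule `e` with bounded payoffs `a` and `b` is integrable. -/
lemma integrable_mul_add_mul_one_sub {𝒳 : Type*} [MeasurableSpace 𝒳] {P : Measure 𝒳}
    [IsFiniteMeasure P] {a b e : 𝒳 → ℝ} {C : ℝ}
    (ha : Measurable a) (hb : Measurable b) (he : Measurable e)
    (haC : ∀ x, |a x| ≤ C) (hbC : ∀ x, |b x| ≤ C) (he01 : ∀ x, e x = 0 ∨ e x = 1) :
    Integrable (fun x => a x * e x + b x * (1 - e x)) P := by
  refine Integrable.of_bound (by fun_prop) C (.of_forall fun x => ?_)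
  rcases he01 x with h | h
  · simpa [h] using hbC x
  · simpa [h] using haC x

/-- The threshold rule `d*(x) = 1{μ̃*(x) ≤ u10(x) + u00(x)}`, where
`μ̃* = (u11 + u10) μhigh + (u00 + u01) μlow`, maximizes the worst-case expected
welfare `Ulow` over all measurable binary decision rules. -/
theorem maxmin_optimal_threshold_rule
    {𝒳 : Type*} [MeasurableSpace 𝒳] (P : Measure 𝒳) [IsProbabilityMeasure P]
    (u11 u10 u00 u01 : 𝒳 → ℝ)
    (hu11m : Measurable u11) (hu10m : Measurable u10)
    (hu00m : Measurable u00) (hu01m : Measurable u01)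
    (hu11 : ∀ x, 0 ≤ u11 x) (hu10 : ∀ x, 0 ≤ u10 x)
    (hu00 : ∀ x, 0 ≤ u00 x) (hu01 : ∀ x, 0 ≤ u01 x)
    (husum : ∀ x, u11 x + u10 x + u00 x + u01 x = 1)
    (μlow μhigh : 𝒳 → ℝ) (hμlm : Measurable μlow) (hμhm : Measurable μhigh)
    (hμbd : ∀ x, 0 ≤ μlow x ∧ μlow x ≤ μhigh x ∧ μhigh x ≤ 1)
    (d : 𝒳 → ℝ) (hdm : Measurable d) (hd01 : ∀ x, d x = 0 ∨ d x = 1) :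
    (∫ x, (u10 x - (u11 x + u10 x) * μhigh x) * d x +
        (-(u00 x) + (u00 x + u01 x) * μlow x) * (1 - d x) ∂P) ≤
    (∫ x, (u10 x - (u11 x + u10 x) * μhigh x) *
          (if (u11 x + u10 x) * μhigh x + (u00 x + u01 x) * μlow x ≤
              u10 x + u00 x then (1 : ℝ) else 0) +
        (-(u00 x) + (u00 x + u01 x) * μlow x) *
          (1 - (if (u11 x + u10 x) * μhigh x + (u00 x + u01 x) * μlow x ≤
              u10 x + u00 x then (1 : ℝ) else 0)) ∂P) := by
  have haC : ∀ x, |u10 x - (u11 x + u10 x) * μhigh x| ≤ 1 := fun x => by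
    obtain ⟨h0, h1, h2⟩ := hμbd x
    have hs : 0 ≤ u11 x + u10 x := add_nonneg (hu11 x) (hu10 x)
    have hlo := mul_nonneg hs (h0.trans h1)
    have hhi := mul_le_of_le_one_right hs h2
    rw [abs_le]
    constructor <;> linarith [husum x, hu11 x, hu10 x, hu00 x, hu01 x]
  have hbC : ∀ x, |-(u00 x) + (u00 x + u01 x) * μlow x| ≤ 1 := fun x => by
    obtain ⟨h0, h1, h2⟩ := hμbd x
    have hs : 0 ≤ u00 x + u01 x := add_nonneg (hu00 x) (hu01 x)
    have hlo := mul_nonneg hs h0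
    have hhi := mul_le_of_le_one_right hs (h1.trans h2)
    rw [abs_le]
    constructor <;> linarith [husum x, hu11 x, hu10 x, hu00 x, hu01 x]
  refine integral_mono
    (integrable_mul_add_mul_one_sub (by fun_prop) (by fun_prop) hdm haC hbC hd01)
    (integrable_mul_add_mul_one_sub (by fun_prop) (by fun_prop) ?_ haC hbC fun x => ?_)
    fun x => ?_
  · exact Measurable.ite (measurableSet_le (by fun_prop) (by fun_prop))
      measurable_const measurable_const
  · split_ifs <;> simp
  · dsimp only
    rcases hd01 x with h | h <;> rw [h] <;> split_ifs <;> linarith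
end

section
/- Let μ̂high, μ̂low : 𝒳 → ℝ be measurable estimates, and let d̂(x) = 1{ (u11(x)+u10(x))·μ̂high(x) + (u00(x)+u01(x))·μ̂low(x) ≤ u10(x) + u00(x) } be the plug-in decision rule, and d* the oracle threshold rule defined with μhigh, μlow in place of the estimates. Then the regret R(d̂) = Ulow(d*) − Ulow(d̂) satisfies R(d̂) ≤ ‖μhigh − μ̂high‖_{L¹(P)} + ‖μlow − μ̂low‖_{L¹(P)}, and consequently R(d̂)² ≤ 2·‖μhigh − μ̂high‖²_{L²(P)} + 2·‖μlow − μ̂low‖²_{L²(P)}. -/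
open MeasureTheory

/-- Worst-case expected welfare of a binary decision rule `d` under the bounds
`[μlow, μhigh]` on the conditional outcome probability. -/
noncomputable def worstCaseWelfare {𝒳 : Type*} [MeasurableSpace 𝒳] (P : Measure 𝒳)
    (u11 u10 u00 u01 μlow μhigh d : 𝒳 → ℝ) : ℝ :=
  ∫ x, (u10 x - (u11 x + u10 x) * μhigh x) * d x +
      (-(u00 x) + (u00 x + u01 x) * μlow x) * (1 - d x) ∂P

/-- The square of the `L¹` norm is at most the integral of the square under a probability
measure. -/
lemma sq_integral_abs_le_integral_sq {𝒳 : Type*} [MeasurableSpace 𝒳] {P : Measure 𝒳}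
    [IsProbabilityMeasure P] {f : 𝒳 → ℝ} (hf : Integrable f P)
    (hf2 : Integrable (fun x => f x ^ 2) P) :
    (∫ x, |f x| ∂P) ^ 2 ≤ ∫ x, f x ^ 2 ∂P := by
  set A := ∫ x, |f x| ∂P with hA
  have hmono : ∫ x, 2 * A * |f x| ∂P ≤ ∫ x, (f x ^ 2 + A ^ 2) ∂P := by
    refine integral_mono (hf.abs.const_mul _) (hf2.add (integrable_const _)) fun x => ?_
    change 2 * A * |f x| ≤ f x ^ 2 + A ^ 2
    nlinarith [sq_nonneg (|f x| - A), sq_abs (f x)]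
  rw [integral_const_mul, integral_add hf2 (integrable_const _), ← hA] at hmono
  simp only [integral_const, probReal_univ, one_smul] at hmono
  linarith

/-- Deciding by the sign of `s` instead of the sign of `t` costs a nonnegative amount, of
at most `|t - s|`. -/
lemma threshold_loss_mem_Icc (t s : ℝ) :
    t * ((if 0 ≤ t then 1 else 0) - (if 0 ≤ s then 1 else 0)) ∈ Set.Icc 0 |t - s| := by
  constructor <;> split_ifs <;> linarith [le_abs_self (t - s), neg_abs_le (t - s)]

lemma abs_mul_add_mul_le {a b : ℝ} (ha : 0 ≤ a) (hb : 0 ≤ b) (hab : a + b = 1) (p q : ℝ) :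
    |a * p + b * q| ≤ |p| + |q| := by
  refine (abs_add_le _ _).trans ?_
  rw [abs_mul, abs_mul, abs_of_nonneg ha, abs_of_nonneg hb]
  nlinarith [abs_nonneg p, abs_nonneg q]

/-- The worst-case welfare integrand of a threshold rule is integrable. -/
lemma integrable_worstCaseWelfare_threshold {𝒳 : Type*} [MeasurableSpace 𝒳] {P : Measure 𝒳}
    [IsProbabilityMeasure P] {u11 u10 u00 u01 μlow μhigh s : 𝒳 → ℝ}
    (hu11m : Measurable u11) (hu10m : Measurable u10)
    (hu00m : Measurable u00) (hu01m : Measurable u01)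
    (hu11 : ∀ x, 0 ≤ u11 x) (hu10 : ∀ x, 0 ≤ u10 x)
    (hu00 : ∀ x, 0 ≤ u00 x) (hu01 : ∀ x, 0 ≤ u01 x)
    (husum : ∀ x, u11 x + u10 x + u00 x + u01 x = 1)
    (hμlm : Measurable μlow) (hμhm : Measurable μhigh)
    (hμbd : ∀ x, 0 ≤ μlow x ∧ μlow x ≤ μhigh x ∧ μhigh x ≤ 1) (hs : Measurable s) :
    Integrable (fun x => (u10 x - (u11 x + u10 x) * μhigh x) * (if 0 ≤ s x then 1 else 0) +
      (-(u00 x) + (u00 x + u01 x) * μlow x) * (1 - (if 0 ≤ s x then 1 else 0))) P := by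
  have hd : Measurable fun x => if 0 ≤ s x then (1 : ℝ) else 0 :=
    Measurable.ite (measurableSet_le measurable_const hs) measurable_const measurable_const
  refine Integrable.of_bound (C := 1) (by fun_prop) (ae_of_all _ fun x => ?_)
  obtain ⟨h0, h1, h2⟩ := hμbd x
  have ha : 0 ≤ u11 x + u10 x := add_nonneg (hu11 x) (hu10 x)
  have hb : 0 ≤ u00 x + u01 x := add_nonneg (hu00 x) (hu01 x)
  have hah := mul_nonneg ha (h0.trans h1)
  have hah' := mul_le_mul_of_nonneg_left h2 ha
  have hbl := mul_nonneg hb h0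
  have hbl' := mul_le_mul_of_nonneg_left (h1.trans h2) hb
  rw [Real.norm_eq_abs, abs_le]
  constructor <;> split_ifs <;> linarith [hu11 x, hu10 x, hu00 x, hu01 x, husum x]

/-- Regret bound for the plug-in decision rule: the regret of the plug-in threshold
rule relative to the oracle max-min rule is bounded by the `L¹(P)` errors of the
estimated conditional probability bounds, and its square by twice the squared `L²(P)`
errors. -/
theorem plug_in_decision_rule_regret_bound
    {𝒳 : Type*} [MeasurableSpace 𝒳] (P : Measure 𝒳) [IsProbabilityMeasure P]
    (u11 u10 u00 u01 : 𝒳 → ℝ)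
    (hu11m : Measurable u11) (hu10m : Measurable u10)
    (hu00m : Measurable u00) (hu01m : Measurable u01)
    (hu11 : ∀ x, 0 ≤ u11 x) (hu10 : ∀ x, 0 ≤ u10 x)
    (hu00 : ∀ x, 0 ≤ u00 x) (hu01 : ∀ x, 0 ≤ u01 x)
    (husum : ∀ x, u11 x + u10 x + u00 x + u01 x = 1)
    (μlow μhigh : 𝒳 → ℝ) (hμlm : Measurable μlow) (hμhm : Measurable μhigh)
    (hμbd : ∀ x, 0 ≤ μlow x ∧ μlow x ≤ μhigh x ∧ μhigh x ≤ 1)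
    (μlh μhh : 𝒳 → ℝ) (hμlhm : Measurable μlh) (hμhhm : Measurable μhh)
    (hint1 : Integrable (fun x => μhigh x - μhh x) P)
    (hint2 : Integrable (fun x => μlow x - μlh x) P)
    (hint3 : Integrable (fun x => (μhigh x - μhh x) ^ 2) P)
    (hint4 : Integrable (fun x => (μlow x - μlh x) ^ 2) P) :
    worstCaseWelfare P u11 u10 u00 u01 μlow μhigh
        (fun x => if (u11 x + u10 x) * μhigh x + (u00 x + u01 x) * μlow x ≤
            u10 x + u00 x then (1 : ℝ) else 0) -
      worstCaseWelfare P u11 u10 u00 u01 μlow μhigh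
        (fun x => if (u11 x + u10 x) * μhh x + (u00 x + u01 x) * μlh x ≤
            u10 x + u00 x then (1 : ℝ) else 0) ≤
      (∫ x, |μhigh x - μhh x| ∂P) + (∫ x, |μlow x - μlh x| ∂P)
    ∧
    (worstCaseWelfare P u11 u10 u00 u01 μlow μhigh
        (fun x => if (u11 x + u10 x) * μhigh x + (u00 x + u01 x) * μlow x ≤
            u10 x + u00 x then (1 : ℝ) else 0) -
      worstCaseWelfare P u11 u10 u00 u01 μlow μhigh
        (fun x => if (u11 x + u10 x) * μhh x + (u00 x + u01 x) * μlh x ≤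
            u10 x + u00 x then (1 : ℝ) else 0)) ^ 2 ≤
      2 * (∫ x, (μhigh x - μhh x) ^ 2 ∂P) + 2 * (∫ x, (μlow x - μlh x) ^ 2 ∂P) := by
  have hrule (p q : 𝒳 → ℝ) : (fun x => if (u11 x + u10 x) * p x + (u00 x + u01 x) * q x ≤
      u10 x + u00 x then (1 : ℝ) else 0) = fun x => if 0 ≤ u10 x + u00 x -
        ((u11 x + u10 x) * p x + (u00 x + u01 x) * q x) then (1 : ℝ) else 0 := by
    simp only [sub_nonneg]
  rw [hrule, hrule]
  unfold worstCaseWelfare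
  set t : 𝒳 → ℝ := fun x => u10 x + u00 x -
    ((u11 x + u10 x) * μhigh x + (u00 x + u01 x) * μlow x) with ht
  set s : 𝒳 → ℝ := fun x => u10 x + u00 x -
    ((u11 x + u10 x) * μhh x + (u00 x + u01 x) * μlh x) with hs
  have htm : Measurable t := by fun_prop
  have hsm : Measurable s := by fun_prop
  have hit := integrable_worstCaseWelfare_threshold (P := P) hu11m hu10m hu00m hu01m hu11 hu10
    hu00 hu01 husum hμlm hμhm hμbd htm
  have his := integrable_worstCaseWelfare_threshold (P := P) hu11m hu10m hu00m hu01m hu11 hu10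
    hu00 hu01 husum hμlm hμhm hμbd hsm
  rw [← integral_sub hit his, ← integral_add hint1.abs hint2.abs]
  have hdiff (x : 𝒳) :
      ((u10 x - (u11 x + u10 x) * μhigh x) * (if 0 ≤ t x then 1 else 0) +
          (-(u00 x) + (u00 x + u01 x) * μlow x) * (1 - (if 0 ≤ t x then 1 else 0))) -
        ((u10 x - (u11 x + u10 x) * μhigh x) * (if 0 ≤ s x then 1 else 0) +
          (-(u00 x) + (u00 x + u01 x) * μlow x) * (1 - (if 0 ≤ s x then 1 else 0))) =
      t x * ((if 0 ≤ t x then 1 else 0) - (if 0 ≤ s x then 1 else 0)) := by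
    simp only [ht]
    ring
  have hle (x : 𝒳) : |t x - s x| ≤ |μhigh x - μhh x| + |μlow x - μlh x| := by
    have heq : t x - s x = -((u11 x + u10 x) * (μhigh x - μhh x) +
        (u00 x + u01 x) * (μlow x - μlh x)) := by
      simp only [ht, hs]
      ring
    rw [heq, abs_neg]
    exact abs_mul_add_mul_le (add_nonneg (hu11 x) (hu10 x)) (add_nonneg (hu00 x) (hu01 x))
      (by linarith [husum x]) _ _
  have hL1 := integral_mono (hit.sub his) (hint1.abs.add hint2.abs) fun x =>
    (hdiff x).trans_le ((threshold_loss_mem_Icc (t x) (s x)).2.trans (hle x))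
  refine ⟨hL1, (pow_le_pow_left₀ (integral_nonneg ?_) hL1 2).trans ?_⟩
  · exact fun x => (threshold_loss_mem_Icc (t x) (s x)).1.trans_eq (hdiff x).symm
  simp only [Pi.add_apply]
  rw [integral_add hint1.abs hint2.abs]
  linarith [add_sq_le (a := ∫ x, |μhigh x - μhh x| ∂P) (b := ∫ x, |μlow x - μlh x| ∂P),
    sq_integral_abs_le_integral_sq hint1 hint3, sq_integral_abs_le_integral_sq hint2 hint4]
end

section
/- Let Λ ≥ 1 and suppose the marginal sensitivity model holds: for each y ∈ {0,1}, Λ⁻¹ ≤ [P(A | B_y)/P(Aᶜ | B_y)]·[P(Aᶜ)/P(A)] ≤ Λ. Then Λ⁻¹·P(B | A) ≤ P(B | Aᶜ) ≤ Λ·P(B | A); equivalently, the confounding difference δ = P(B | Aᶜ) − P(B | A) satisfies (Λ⁻¹ − 1)·P(B | A) ≤ δ ≤ (Λ − 1)·P(B | A). -/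
open MeasureTheory

/-- Conditional probability `P(E | F) = P(E ∩ F) / P(F)` as a real number. -/
noncomputable def condProb {Ω : Type*} [MeasurableSpace Ω] (P : Measure Ω)
    (E F : Set Ω) : ℝ := (P (E ∩ F)).toReal / (P F).toReal

/-- Bayes' rule in odds form: the selection odds ratio given `C` equals the ratio of the conditional
probabilities of `C` given `E` and given `F`. -/
theorem condProb_div_condProb_mul_odds {Ω : Type*} [MeasurableSpace Ω] (P : Measure Ω)
    (E F C : Set Ω) (hC : (P C).toReal ≠ 0) :
    condProb P E C / condProb P F C * ((P F).toReal / (P E).toReal) =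
      condProb P C E / condProb P C F := by
  simp only [condProb, Set.inter_comm C]
  rw [div_div_div_cancel_right₀ hC, div_mul_div_comm, div_div_div_eq, mul_comm (P E).toReal]

/-- The marginal sensitivity model implies nonparametric outcome bounds:
if the selection odds ratio is bounded in `[Λ⁻¹, Λ]` at each outcome value, then
`Λ⁻¹ P(B|A) ≤ P(B|Aᶜ) ≤ Λ P(B|A)`; equivalently, the confounding difference
`δ = P(B|Aᶜ) − P(B|A)` satisfies `(Λ⁻¹ − 1) P(B|A) ≤ δ ≤ (Λ − 1) P(B|A)`. -/
theorem marginal_sensitivity_model_implies_outcome_bounds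
    {Ω : Type*} [MeasurableSpace Ω] (P : Measure Ω) [IsProbabilityMeasure P]
    (A B : Set Ω) (hA : MeasurableSet A) (hB : MeasurableSet B)
    (hPA : 0 < (P A).toReal) (hPA1 : (P A).toReal < 1)
    (hPB : 0 < (P B).toReal) (hPB1 : (P B).toReal < 1)
    (hpos : ∀ C : Set Ω, C = B ∨ C = Bᶜ →
      0 < (P (A ∩ C)).toReal ∧ 0 < (P (Aᶜ ∩ C)).toReal)
    (Λ : ℝ) (hΛ : 1 ≤ Λ)
    (hMSM : ∀ C : Set Ω, C = B ∨ C = Bᶜ →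
      Λ⁻¹ ≤ condProb P A C / condProb P Aᶜ C *
              ((P Aᶜ).toReal / (P A).toReal) ∧
      condProb P A C / condProb P Aᶜ C *
              ((P Aᶜ).toReal / (P A).toReal) ≤ Λ) :
    (Λ⁻¹ * condProb P B A ≤ condProb P B Aᶜ ∧
      condProb P B Aᶜ ≤ Λ * condProb P B A) ∧
    ((Λ⁻¹ - 1) * condProb P B A ≤ condProb P B Aᶜ - condProb P B A ∧
      condProb P B Aᶜ - condProb P B A ≤ (Λ - 1) * condProb P B A) := by
  have hcompl : 0 < (P Aᶜ).toReal :=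
    (hpos B (.inl rfl)).2.trans_le
      (ENNReal.toReal_mono (measure_ne_top P _) (measure_mono Set.inter_subset_left))
  have hq : 0 < condProb P B Aᶜ := by
    rw [condProb, Set.inter_comm]
    exact div_pos (hpos B (.inl rfl)).2 hcompl
  obtain ⟨hlow, hupp⟩ := hMSM B (.inl rfl)
  rw [condProb_div_condProb_mul_odds P A Aᶜ B hPB.ne'] at hlow hupp
  have hΛ_pos : 0 < Λ := zero_lt_one.trans_le hΛ
  have hlower : Λ⁻¹ * condProb P B A ≤ condProb P B Aᶜ :=
    (inv_mul_le_iff₀ hΛ_pos).2 ((div_le_iff₀ hq).1 hupp)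
  have hupper : condProb P B Aᶜ ≤ Λ * condProb P B A :=
    (inv_mul_le_iff₀ hΛ_pos).1 ((le_div_iff₀ hq).1 hlow)
  refine ⟨⟨hlower, hupper⟩, ?_, ?_⟩ <;> linarith
end

section
/- Let 0 < Γlow ≤ Γhigh and suppose Γlow·P(B | A) ≤ P(B | Aᶜ) ≤ Γhigh·P(B | A) with P(B | A) > 0 and P(B | Aᶜ) > 0. Then Γhigh⁻¹ ≤ [P(A | B)·P(Aᶜ)] / [P(Aᶜ | B)·P(A)] ≤ Γlow⁻¹; that is, nonparametric outcome bounds imply a marginal-sensitivity-model-type bound on the selection odds ratio at the outcome value Y* = 1. -/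
open MeasureTheory

/-- Bayes' rule in odds form: the odds ratio of `A` given `B` is the likelihood ratio of `B`. -/
theorem condProb_odds_ratio_eq {Ω : Type*} [MeasurableSpace Ω] (P : Measure Ω)
    (A B : Set Ω) (hB : (P B).toReal ≠ 0) :
    condProb P A B * (P Aᶜ).toReal / (condProb P Aᶜ B * (P A).toReal) =
      condProb P B A / condProb P B Aᶜ := by
  unfold condProb
  rw [Set.inter_comm B A, Set.inter_comm B Aᶜ]
  field_simp

/-- Nonparametric outcome bounds imply a marginal-sensitivity-model-type bound on the
selection odds ratio at the outcome value `Y* = 1`: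
if `Γlow P(B|A) ≤ P(B|Aᶜ) ≤ Γhigh P(B|A)` then
`Γhigh⁻¹ ≤ [P(A|B) P(Aᶜ)] / [P(Aᶜ|B) P(A)] ≤ Γlow⁻¹`. -/
theorem outcome_bounds_imply_MSM_type_bound
    {Ω : Type*} [MeasurableSpace Ω] (P : Measure Ω) [IsProbabilityMeasure P]
    (A B : Set Ω) (hA : MeasurableSet A) (hB : MeasurableSet B)
    (hPA : 0 < (P A).toReal) (hPA1 : (P A).toReal < 1)
    (hPB : 0 < (P B).toReal) (hPB1 : (P B).toReal < 1)
    (hpos : ∀ C : Set Ω, C = B ∨ C = Bᶜ →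
      0 < (P (A ∩ C)).toReal ∧ 0 < (P (Aᶜ ∩ C)).toReal)
    (Γlow Γhigh : ℝ) (hΓ0 : 0 < Γlow) (hΓ : Γlow ≤ Γhigh)
    (hlb : Γlow * condProb P B A ≤ condProb P B Aᶜ)
    (hub : condProb P B Aᶜ ≤ Γhigh * condProb P B A)
    (hBA : 0 < condProb P B A) (hBAc : 0 < condProb P B Aᶜ) :
    Γhigh⁻¹ ≤ condProb P A B * (P Aᶜ).toReal /
        (condProb P Aᶜ B * (P A).toReal) ∧
      condProb P A B * (P Aᶜ).toReal /
        (condProb P Aᶜ B * (P A).toReal) ≤ Γlow⁻¹ := by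
  rw [condProb_odds_ratio_eq P A B hPB.ne']
  have hΓhigh : 0 < Γhigh := hΓ0.trans_le hΓ
  constructor
  · rwa [le_div_iff₀ hBAc, inv_mul_le_iff₀ hΓhigh]
  · rwa [div_le_iff₀ hBAc, le_inv_mul_iff₀ hΓ0]
end

section
/- Let Γ ≥ 1 and suppose Rosenbaum's Γ-sensitivity model holds: for all y, ỹ ∈ {0,1}, Γ⁻¹ ≤ [P(A | B_y)/P(Aᶜ | B_y)]·[P(Aᶜ | B_ỹ)/P(A | B_ỹ)] ≤ Γ. Then Γ⁻¹·P(B | A) ≤ P(B | Aᶜ) ≤ Γ·P(B | A); equivalently, (Γ⁻¹ − 1)·P(B | A) ≤ P(B | Aᶜ) − P(B | A) ≤ (Γ − 1)·P(B | A). -/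
open MeasureTheory

/-- In a two-by-two table with positive entries, bounds on the odds ratio pass to the
ratio of the row proportions. -/
lemma mul_le_and_le_mul_of_odds_ratio_bounds {a b c d Γ : ℝ}
    (ha : 0 < a) (hb : 0 < b) (hc : 0 < c) (hd : 0 < d) (hΓ : 1 ≤ Γ)
    (hl : Γ⁻¹ ≤ a / b * (d / c)) (hu : a / b * (d / c) ≤ Γ) :
    Γ⁻¹ * (a / (a + c)) ≤ b / (b + d) ∧ b / (b + d) ≤ Γ * (a / (a + c)) := by
  have hΓ₀ : 0 < Γ := by linarith
  have hbc : 0 < b * c := mul_pos hb hc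
  have hab : a * b ≤ Γ * (a * b) := le_mul_of_one_le_left (by positivity) hΓ
  rw [div_mul_div_comm] at hl hu
  rw [div_le_iff₀ hbc] at hu
  rw [le_div_iff₀ hbc, inv_mul_le_iff₀ hΓ₀] at hl
  constructor
  · rw [inv_mul_le_iff₀ hΓ₀, ← mul_div_assoc, div_le_div_iff₀ (by positivity) (by positivity)]
    linarith
  · rw [← mul_div_assoc, div_le_div_iff₀ (by positivity) (by positivity)]
    linarith

/-- Rosenbaum's Γ-sensitivity model implies nonparametric outcome bounds:
if the selection odds ratios across outcome values lie in `[Γ⁻¹, Γ]`, then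
`Γ⁻¹ P(B|A) ≤ P(B|Aᶜ) ≤ Γ P(B|A)`; equivalently,
`(Γ⁻¹ − 1) P(B|A) ≤ P(B|Aᶜ) − P(B|A) ≤ (Γ − 1) P(B|A)`. -/
theorem rosenbaum_sensitivity_model_implies_outcome_bounds
    {Ω : Type*} [MeasurableSpace Ω] (P : Measure Ω) [IsProbabilityMeasure P]
    (A B : Set Ω) (hA : MeasurableSet A) (hB : MeasurableSet B)
    (hPA : 0 < (P A).toReal) (hPA1 : (P A).toReal < 1)
    (hPB : 0 < (P B).toReal) (hPB1 : (P B).toReal < 1)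
    (hpos : ∀ C : Set Ω, C = B ∨ C = Bᶜ →
      0 < (P (A ∩ C)).toReal ∧ 0 < (P (Aᶜ ∩ C)).toReal)
    (Γ : ℝ) (hΓ : 1 ≤ Γ)
    (hRos : ∀ C C' : Set Ω, C = B ∨ C = Bᶜ → C' = B ∨ C' = Bᶜ →
      Γ⁻¹ ≤ (condProb P A C / condProb P Aᶜ C) *
              (condProb P Aᶜ C' / condProb P A C') ∧
      (condProb P A C / condProb P Aᶜ C) *
              (condProb P Aᶜ C' / condProb P A C') ≤ Γ) :
    (Γ⁻¹ * condProb P B A ≤ condProb P B Aᶜ ∧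
      condProb P B Aᶜ ≤ Γ * condProb P B A) ∧
    ((Γ⁻¹ - 1) * condProb P B A ≤ condProb P B Aᶜ - condProb P B A ∧
      condProb P B Aᶜ - condProb P B A ≤ (Γ - 1) * condProb P B A) := by
  obtain ⟨ha, hb⟩ := hpos B (Or.inl rfl)
  obtain ⟨hc, hd⟩ := hpos Bᶜ (Or.inr rfl)
  obtain ⟨hl, hu⟩ := hRos B Bᶜ (Or.inl rfl) (Or.inr rfl)
  have hBc : 0 < (P Bᶜ).toReal :=
    hc.trans_le (measureReal_mono (μ := P) Set.inter_subset_right)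
  have hAsum : (P A).toReal = (P (A ∩ B)).toReal + (P (A ∩ Bᶜ)).toReal :=
    (measureReal_inter_add_sdiff (μ := P) (s := A) hB).symm
  have hAcsum : (P Aᶜ).toReal = (P (Aᶜ ∩ B)).toReal + (P (Aᶜ ∩ Bᶜ)).toReal :=
    (measureReal_inter_add_sdiff (μ := P) (s := Aᶜ) hB).symm
  simp only [condProb] at hl hu ⊢
  rw [div_div_div_cancel_right₀ hPB.ne', div_div_div_cancel_right₀ hBc.ne'] at hl hu
  rw [Set.inter_comm B A, Set.inter_comm B Aᶜ, hAsum, hAcsum]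
  generalize (P (A ∩ B)).toReal = a at *
  generalize (P (Aᶜ ∩ B)).toReal = b at *
  generalize (P (A ∩ Bᶜ)).toReal = c at *
  generalize (P (Aᶜ ∩ Bᶜ)).toReal = d at *
  obtain ⟨h₁, h₂⟩ := mul_le_and_le_mul_of_odds_ratio_bounds ha hb hc hd hΓ hl hu
  exact ⟨⟨h₁, h₂⟩, by linarith, by linarith⟩
end

section
/- Let C ≥ 0 and set V = P(A)·(1 − P(A)). Then |P(B | Aᶜ) − P(B | A)| ≤ C if and only if max_{y∈{0,1}} |P(A | B_y) − P(A)| ≤ C·max{ V/P(B), V/P(Bᶜ) }; that is, a bound on the confounding function is equivalent to a partial c-dependence bound on the selection probability with c = C·max{ V/P(B), V/P(Bᶜ) }. -/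
open MeasureTheory

/-- Equivalence between a bound on the confounding function and partial c-dependence:
with `V = P(A)(1 − P(A))`, one has `|P(B|Aᶜ) − P(B|A)| ≤ C` if and only if
`max_{y} |P(A|B_y) − P(A)| ≤ C · max{V/P(B), V/P(Bᶜ)}`. -/
theorem confounding_bound_iff_partial_c_dependence
    {Ω : Type*} [MeasurableSpace Ω] (P : Measure Ω) [IsProbabilityMeasure P]
    (A B : Set Ω) (hA : MeasurableSet A) (hB : MeasurableSet B)
    (hPA : 0 < (P A).toReal) (hPA1 : (P A).toReal < 1)
    (hPB : 0 < (P B).toReal) (hPB1 : (P B).toReal < 1)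
    (hpos : ∀ C : Set Ω, C = B ∨ C = Bᶜ →
      0 < (P (A ∩ C)).toReal ∧ 0 < (P (Aᶜ ∩ C)).toReal)
    (C : ℝ) (hC : 0 ≤ C) :
    |condProb P B Aᶜ - condProb P B A| ≤ C ↔
      max |condProb P A B - (P A).toReal| |condProb P A Bᶜ - (P A).toReal| ≤
        C * max ((P A).toReal * (1 - (P A).toReal) / (P B).toReal)
                ((P A).toReal * (1 - (P A).toReal) / (P Bᶜ).toReal) := by
  have hAc : (P Aᶜ).toReal = 1 - (P A).toReal := probReal_compl_eq_one_sub hA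
  have hBc : (P Bᶜ).toReal = 1 - (P B).toReal := probReal_compl_eq_one_sub hB
  have hBA : (P (B ∩ Aᶜ)).toReal = (P B).toReal - (P (A ∩ B)).toReal := by
    have h := measureReal_inter_add_sdiff (μ := P) (s := B) hA
    rw [Set.sdiff_eq, Set.inter_comm B A] at h
    simp only [Measure.real] at h
    linarith
  have hAB : (P (A ∩ Bᶜ)).toReal = (P A).toReal - (P (A ∩ B)).toReal := by
    have h := measureReal_inter_add_sdiff (μ := P) (s := A) hB
    rw [Set.sdiff_eq] at h
    simp only [Measure.real] at h
    linarith
  simp only [condProb, hAc, hBc, hBA, hAB, Set.inter_comm B A]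
  generalize (P A).toReal = a at *
  generalize (P B).toReal = b at *
  generalize (P (A ∩ B)).toReal = m at *
  have ha : 0 < 1 - a := by linarith
  have hb : 0 < 1 - b := by linarith
  have hV : 0 < a * (1 - a) / b := by positivity
  have hV' : 0 < a * (1 - a) / (1 - b) := by positivity
  have h₁ : |m / b - a| = |(b - m) / (1 - a) - m / a| * (a * (1 - a) / b) := by
    rw [← abs_of_pos hV, ← abs_mul, ← abs_neg]
    congr 1
    field_simp
    ring
  have h₂ : |(a - m) / (1 - b) - a| =
      |(b - m) / (1 - a) - m / a| * (a * (1 - a) / (1 - b)) := by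
    rw [← abs_of_pos hV', ← abs_mul]
    congr 1
    field_simp
    ring
  rw [h₁, h₂, ← mul_max_of_nonneg _ _ (abs_nonneg _)]
  exact (mul_le_mul_iff_of_pos_right (lt_max_of_lt_left hV)).symm
end

section
/- Let γ, μ̃ ∈ [0,1] and consider the feasible set S = { (p00, p01, p10, p11) ∈ ℝ⁴ : all pᵢⱼ ≥ 0, p11 + p00 = γ, p11 + p01 = μ̃, p00 + p01 + p10 + p11 = 1 }. Then S is nonempty, and the maximum over S of p11 + p10 equals 1 − |γ − μ̃|, while the minimum over S of p11 + p10 equals |1 − γ − μ̃|; both extrema are attained. -/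
/-- Sharp bounds in the proxy outcome linear program: over the feasible set of joint
probabilities `(p00, p01, p10, p11)` with agreement probability `γ` and proxy mean `μ̃`,
the quantity `p11 + p10` attains maximum `1 − |γ − μ̃|` and minimum `|1 − γ − μ̃|`,
and the feasible set is nonempty. -/
theorem proxy_outcome_linear_program_bounds
    (γ μt : ℝ) (hγ : γ ∈ Set.Icc (0 : ℝ) 1) (hμt : μt ∈ Set.Icc (0 : ℝ) 1) :
    {r : ℝ | ∃ p00 p01 p10 p11 : ℝ,
        0 ≤ p00 ∧ 0 ≤ p01 ∧ 0 ≤ p10 ∧ 0 ≤ p11 ∧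
        p11 + p00 = γ ∧ p11 + p01 = μt ∧
        p00 + p01 + p10 + p11 = 1 ∧ r = p11 + p10}.Nonempty ∧
    IsGreatest
      {r : ℝ | ∃ p00 p01 p10 p11 : ℝ,
        0 ≤ p00 ∧ 0 ≤ p01 ∧ 0 ≤ p10 ∧ 0 ≤ p11 ∧
        p11 + p00 = γ ∧ p11 + p01 = μt ∧
        p00 + p01 + p10 + p11 = 1 ∧ r = p11 + p10}
      (1 - |γ - μt|) ∧
    IsLeast
      {r : ℝ | ∃ p00 p01 p10 p11 : ℝ,
        0 ≤ p00 ∧ 0 ≤ p01 ∧ 0 ≤ p10 ∧ 0 ≤ p11 ∧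
        p11 + p00 = γ ∧ p11 + p01 = μt ∧
        p00 + p01 + p10 + p11 = 1 ∧ r = p11 + p10}
      |1 - γ - μt| := by
  obtain ⟨hγ0, hγ1⟩ := hγ
  obtain ⟨hμ0, hμ1⟩ := hμt
  have hmax : IsGreatest
      {r : ℝ | ∃ p00 p01 p10 p11 : ℝ,
        0 ≤ p00 ∧ 0 ≤ p01 ∧ 0 ≤ p10 ∧ 0 ≤ p11 ∧
        p11 + p00 = γ ∧ p11 + p01 = μt ∧
        p00 + p01 + p10 + p11 = 1 ∧ r = p11 + p10}
      (1 - |γ - μt|) := by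
    constructor
    · rcases le_total γ μt with h | h
      · rw [abs_of_nonpos (by linarith)]
        refine ⟨0, μt - γ, 1 - μt, γ, ?_, ?_, ?_, ?_, ?_, ?_, ?_, ?_⟩ <;> linarith
      · rw [abs_of_nonneg (by linarith)]
        refine ⟨γ - μt, 0, 1 - γ, μt, ?_, ?_, ?_, ?_, ?_, ?_, ?_, ?_⟩ <;> linarith
    · rintro r ⟨p00, p01, p10, p11, h00, h01, h10, h11, hag, hpr, hsum, rfl⟩
      have : |γ - μt| ≤ p00 + p01 := abs_le.2 ⟨by linarith, by linarith⟩
      linarith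
  refine ⟨hmax.nonempty, hmax, ?_, ?_⟩
  · rcases le_total (γ + μt) 1 with h | h
    · rw [abs_of_nonneg (by linarith)]
      refine ⟨γ, μt, 1 - γ - μt, 0, ?_, ?_, ?_, ?_, ?_, ?_, ?_, ?_⟩ <;> linarith
    · rw [abs_of_nonpos (by linarith)]
      refine ⟨1 - μt, 1 - γ, 0, γ + μt - 1, ?_, ?_, ?_, ?_, ?_, ?_, ?_, ?_⟩ <;> linarith
  · rintro r ⟨p00, p01, p10, p11, h00, h01, h10, h11, hag, hpr, hsum, rfl⟩
    exact abs_le.2 ⟨by linarith, by linarith⟩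
end

section
/- Let B and C be events in a probability space with P((B ∩ C) ∪ (Bᶜ ∩ Cᶜ)) = γ (the probability that B and C agree) and P(C) = μ̃. Then |1 − γ − μ̃| ≤ P(B) ≤ 1 − |γ − μ̃|. (Applied with B = {Y* = 1} and C = {Ỹ = 1} under the conditional law given D = 0 and X = x, this gives the proxy outcome bounds on P(Y* = 1 | D = 0, X = x).) -/
open MeasureTheory

/-- Proxy outcome bounds: if `γ` is the probability that the events `B` and `C` agree
and `μ̃ = P(C)`, then `|1 − γ − μ̃| ≤ P(B) ≤ 1 − |γ − μ̃|`. -/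
theorem proxy_outcome_bounds
    {Ω : Type*} [MeasurableSpace Ω] (P : Measure Ω) [IsProbabilityMeasure P]
    (B C : Set Ω) (hB : MeasurableSet B) (hC : MeasurableSet C)
    (γ μt : ℝ)
    (hγ : γ = (P ((B ∩ C) ∪ (Bᶜ ∩ Cᶜ))).toReal)
    (hμt : μt = (P C).toReal) :
    |1 - γ - μt| ≤ (P B).toReal ∧ (P B).toReal ≤ 1 - |γ - μt| := by
  change γ = P.real _ at hγ
  change μt = P.real C at hμt
  change _ ≤ P.real B ∧ P.real B ≤ _
  have hdisj : Disjoint (B ∩ C) (Bᶜ ∩ Cᶜ) :=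
    disjoint_compl_right.mono Set.inter_subset_left Set.inter_subset_left
  rw [measureReal_union hdisj (hB.compl.inter hC.compl)] at hγ
  have hB_split := measureReal_inter_add_sdiff (μ := P) (s := B) hC
  have hC_split := measureReal_inter_add_sdiff (μ := P) (s := C) hB
  have hBc_split := measureReal_inter_add_sdiff (μ := P) (s := Bᶜ) hC
  have hB_compl := probReal_compl_eq_one_sub (μ := P) hB
  rw [Set.inter_comm C B, Set.sdiff_eq, Set.inter_comm C Bᶜ] at hC_split
  rw [Set.sdiff_eq] at hB_split hBc_split
  have h₁ : 0 ≤ P.real (B ∩ C) := measureReal_nonneg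
  have h₂ : 0 ≤ P.real (B ∩ Cᶜ) := measureReal_nonneg
  have h₃ : 0 ≤ P.real (Bᶜ ∩ C) := measureReal_nonneg
  have h₄ : 0 ≤ P.real (Bᶜ ∩ Cᶜ) := measureReal_nonneg
  refine ⟨abs_le.2 ⟨by linarith, by linarith⟩, ?_⟩
  have h : |γ - μt| ≤ 1 - P.real B := abs_le.2 ⟨by linarith, by linarith⟩
  linarith
end

section
/- Let A, B, Z be events in a probability space with P(Z) > 0, 0 < P(A) < 1, and suppose the exclusion restriction P(B | Z) = P(B) holds. Then P(B ∩ A | Z) ≤ P(B) ≤ P(B ∩ A | Z) + P(Aᶜ | Z). Consequently, writing λ = P(B ∩ A | Z), κ = P(Aᶜ | Z), μ1 = P(B | A), π0 = P(Aᶜ), and δ = P(B | Aᶜ) − P(B | A), we have (λ − μ1)/π0 ≤ δ ≤ (κ + λ − μ1)/π0 (the Manski instrumental variable bounds at instrument value z). -/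
open MeasureTheory

theorem condProb_mono {Ω : Type*} [MeasurableSpace Ω] (P : Measure Ω) [IsFiniteMeasure P]
    {E F : Set Ω} (h : E ⊆ F) (Z : Set Ω) : condProb P E Z ≤ condProb P F Z :=
  div_le_div_of_nonneg_right (measureReal_mono (Set.inter_subset_inter_left Z h))
    ENNReal.toReal_nonneg

theorem condProb_union_le {Ω : Type*} [MeasurableSpace Ω] (P : Measure Ω) [IsFiniteMeasure P]
    (E F Z : Set Ω) : condProb P (E ∪ F) Z ≤ condProb P E Z + condProb P F Z := by
  unfold condProb
  rw [← add_div, Set.union_inter_distrib_right]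
  exact div_le_div_of_nonneg_right (measureReal_union_le _ _) ENNReal.toReal_nonneg

theorem condProb_compl_sub_condProb {Ω : Type*} [MeasurableSpace Ω] (P : Measure Ω)
    [IsProbabilityMeasure P] {A : Set Ω} (B : Set Ω) (hA : MeasurableSet A)
    (hPA : 0 < (P A).toReal) (hPA1 : (P A).toReal < 1) :
    condProb P B Aᶜ - condProb P B A =
      ((P B).toReal - condProb P B A) / (P Aᶜ).toReal := by
  have hc : (P Aᶜ).toReal = 1 - (P A).toReal := probReal_compl_eq_one_sub hA
  have hB : (P (B ∩ A)).toReal + (P (B ∩ Aᶜ)).toReal = (P B).toReal :=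
    measureReal_inter_add_sdiff hA
  have hA0 := hPA.ne'
  have hc0 : 1 - (P A).toReal ≠ 0 := (sub_pos.mpr hPA1).ne'
  unfold condProb
  rw [hc, ← hB]
  field_simp
  ring

/-- Manski instrumental variable bounds: under the exclusion restriction
`P(B | Z) = P(B)`, one has `P(B ∩ A | Z) ≤ P(B) ≤ P(B ∩ A | Z) + P(Aᶜ | Z)`;
consequently, the confounding difference `δ = P(B|Aᶜ) − P(B|A)` satisfies
`(λ − μ1)/π0 ≤ δ ≤ (κ + λ − μ1)/π0` with `λ = P(B ∩ A | Z)`, `κ = P(Aᶜ | Z)`,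
`μ1 = P(B|A)`, and `π0 = P(Aᶜ)`. -/
theorem manski_instrumental_variable_bounds
    {Ω : Type*} [MeasurableSpace Ω] (P : Measure Ω) [IsProbabilityMeasure P]
    (A B Z : Set Ω) (hA : MeasurableSet A) (hB : MeasurableSet B)
    (hZ : MeasurableSet Z)
    (hPZ : 0 < (P Z).toReal)
    (hPA : 0 < (P A).toReal) (hPA1 : (P A).toReal < 1)
    (hexcl : condProb P B Z = (P B).toReal) :
    (condProb P (B ∩ A) Z ≤ (P B).toReal ∧
      (P B).toReal ≤ condProb P (B ∩ A) Z + condProb P Aᶜ Z) ∧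
    ((condProb P (B ∩ A) Z - condProb P B A) / (P Aᶜ).toReal ≤
        condProb P B Aᶜ - condProb P B A ∧
      condProb P B Aᶜ - condProb P B A ≤
        (condProb P Aᶜ Z + condProb P (B ∩ A) Z - condProb P B A) /
          (P Aᶜ).toReal) := by
  have lower : condProb P (B ∩ A) Z ≤ (P B).toReal :=
    hexcl ▸ condProb_mono P Set.inter_subset_left Z
  have upper : (P B).toReal ≤ condProb P (B ∩ A) Z + condProb P Aᶜ Z := by
    rw [← hexcl]
    refine (condProb_mono P (fun x hx => ?_) Z).trans (condProb_union_le P (B ∩ A) Aᶜ Z)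
    by_cases h : x ∈ A
    · exact Or.inl ⟨hx, h⟩
    · exact Or.inr h
  refine ⟨⟨lower, upper⟩, ?_⟩
  rw [condProb_compl_sub_condProb P B hA hPA hPA1]
  exact ⟨div_le_div_of_nonneg_right (by linarith) ENNReal.toReal_nonneg,
    div_le_div_of_nonneg_right (by linarith) ENNReal.toReal_nonneg⟩
end
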